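/- arXiv:2407.19159 — 5 statements merged into one kernel-verified Lean document; each statement's English description precedes it below -/
import Mathlib

section
/- For every μ ∈ [0, 1/2] and every c ∈ [2.1, 2.1 + 10⁻⁶], at every point x ∈ Σ_{μ,c} the Hessian D²K_{μ,c}(x) is positive definite on the tangent hyperplane ker DK_{μ,c}(x) (note DK_{μ,c}(x) ≠ 0 on Σ_{μ,c}); equivalently, the Gauss–Kronecker curvature of the hypersurface Σ_{μ,c} is everywhere positive. -/
open Matrix Set

noncomputable section

/-- Phase space ℝ⁴. -/
abbrev V4 := Fin 4 → ℝ

/-- 2×2 real matrices. -/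
abbrev M2 := Matrix (Fin 2) (Fin 2) ℝ

/-- Euclidean norm on ℝ⁴. -/
def enorm4 (v : V4) : ℝ := Real.sqrt (∑ i, (v i)^2)

/-- The gradient of `H : ℝ⁴ → ℝ` with respect to the standard Euclidean structure. -/
def gradient4 (H : V4 → ℝ) (x : V4) : V4 := fun i => fderiv ℝ H x (Pi.single i (1:ℝ))

/-- The Hamiltonian vector field of `H` with respect to the symplectic form `dw ∧ dz`
in coordinates `(z₁, z₂, w₁, w₂)`:  ż = ∂H/∂w, ẇ = -∂H/∂z  (i.e. X_H = I₄∇H). -/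
def symplGrad (H : V4 → ℝ) (x : V4) : V4 :=
  ![fderiv ℝ H x (Pi.single (2:Fin 4) (1:ℝ)), fderiv ℝ H x (Pi.single (3:Fin 4) (1:ℝ)),
    -fderiv ℝ H x (Pi.single (0:Fin 4) (1:ℝ)), -fderiv ℝ H x (Pi.single (1:Fin 4) (1:ℝ))]

/-- `γ : ℝ → ℝ⁴` is a solution of Hamilton's equations for `H` staying in the domain `D`. -/
def IsOrbit (H : V4 → ℝ) (D : Set V4) (γ : ℝ → V4) : Prop :=
  ∀ t : ℝ, γ t ∈ D ∧ HasDerivAt γ (symplGrad H (γ t)) t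

/-- The Jacobi Hamiltonian of the planar restricted three-body problem, in coordinates
`(q₁, q₂, p₁, p₂)`:  H = ½|p|² + q₁p₂ - q₂p₁ - (1-μ)/|q-(-μ,0)| - μ/|q-(1-μ,0)|. -/
def JacobiH (μ : ℝ) (x : V4) : ℝ :=
  (1/2) * ((x 2)^2 + (x 3)^2) + x 0 * x 3 - x 1 * x 2
    - (1 - μ) / Real.sqrt ((x 0 + μ)^2 + (x 1)^2)
    - μ / Real.sqrt ((x 0 - (1 - μ))^2 + (x 1)^2)

/-- The domain of the Jacobi Hamiltonian: `q ∉ {(-μ,0), (1-μ,0)}`. -/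
def JacobiDom (μ : ℝ) : Set V4 :=
  {x | (x 0, x 1) ≠ (-μ, 0) ∧ (x 0, x 1) ≠ (1 - μ, 0)}

/-- The set of critical values of the Jacobi Hamiltonian. -/
def JacobiCritVals (μ : ℝ) : Set ℝ :=
  {v | ∃ x ∈ JacobiDom μ, fderiv ℝ (JacobiH μ) x = 0 ∧ JacobiH μ x = v}

/-- The first critical energy `c₁(μ) = -H(L₁)`, where `H(L₁)` is the smallest critical
value of the Jacobi Hamiltonian. -/
def firstCritEnergy (μ : ℝ) : ℝ := -sInf (JacobiCritVals μ)

/-- `|2z² - 1|` as a function of `(z₁, z₂)`, where `z = z₁ + i z₂`. -/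
def lcAbs (z1 z2 : ℝ) : ℝ := Real.sqrt ((2*(z1^2 - z2^2) - 1)^2 + (4*z1*z2)^2)

/-- The domain of the Levi-Civita Hamiltonian: `2z² ≠ 1`. -/
def LCDom : Set V4 := {x | lcAbs (x 0) (x 1) ≠ 0}

/-- The Levi-Civita Hamiltonian `K_{μ,c}` in coordinates `(z₁, z₂, w₁, w₂)`. -/
def Kham (μ c : ℝ) (x : V4) : ℝ :=
  (1/2) * ((x 2)^2 + (x 3)^2) + c * ((x 0)^2 + (x 1)^2) - (1 - μ)/2
    + 2 * ((x 0)^2 + (x 1)^2) * (x 0 * x 3 - x 1 * x 2)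
    - μ * (x 0 * x 3 + x 1 * x 2)
    - μ * ((x 0)^2 + (x 1)^2) / lcAbs (x 0) (x 1)

/-- `Σ_{μ,c}`: the connected component of `K_{μ,c}⁻¹(0)` containing the circle
`{(0,w) : |w|² = 1-μ}` (we use the point `(0,0,√(1-μ),0)` of that circle). -/
def SigmaLC (μ c : ℝ) : Set V4 :=
  connectedComponentIn {x : V4 | x ∈ LCDom ∧ Kham μ c x = 0} ![0, 0, Real.sqrt (1 - μ), 0]

/-- The anti-symplectic involution `R₊(z,w) = (z̄, -w̄)`. -/
def Rplus (x : V4) : V4 := ![x 0, -x 1, -x 2, x 3]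

/-- The anti-symplectic involution `R₋(z,w) = (-z̄, w̄)`. -/
def Rminus (x : V4) : V4 := ![-x 0, x 1, x 2, -x 3]

/-- A `T`-periodic orbit of the Levi-Civita Hamiltonian flow lying on `Σ_{μ,c}`. -/
def IsClosedOrbit (μ c T : ℝ) (γ : ℝ → V4) : Prop :=
  0 < T ∧ IsOrbit (Kham μ c) LCDom γ ∧ (∀ t, γ (t + T) = γ t) ∧ ∀ t, γ t ∈ SigmaLC μ c

/-- A `T`-periodic orbit is symmetric if, after a time shift, `γ(t) = R₊(γ(T-t))` for all `t`
or `γ(t) = R₋(γ(T-t))` for all `t`. -/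
def IsSymmetricOrbit (T : ℝ) (γ : ℝ → V4) : Prop :=
  ∃ s : ℝ, (∀ t, γ (s + t) = Rplus (γ (s + (T - t))))
         ∨ (∀ t, γ (s + t) = Rminus (γ (s + (T - t))))

/-- An orbit `(z(t),w(t))` is retrograde if `z₁w₂ - z₂w₁ > μ(z₁² - z₂²)` along it. -/
def IsRetrograde (μ : ℝ) (γ : ℝ → V4) : Prop :=
  ∀ t : ℝ, μ * ((γ t 0)^2 - (γ t 1)^2) < γ t 0 * γ t 3 - γ t 1 * γ t 2

/-- An orbit `(z(t),w(t))` is direct if `z₁w₂ - z₂w₁ < μ(z₁² - z₂²)` along it. -/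
def IsDirect (μ : ℝ) (γ : ℝ → V4) : Prop :=
  ∀ t : ℝ, γ t 0 * γ t 3 - γ t 1 * γ t 2 < μ * ((γ t 0)^2 - (γ t 1)^2)

/-- The crossing number of a `T`-periodic orbit: `#{t ∈ [0,T) : z₁(t) = 0 or z₂(t) = 0}`. -/
def crossingNumber (T : ℝ) (γ : ℝ → V4) : ℕ :=
  {t ∈ Set.Ico (0:ℝ) T | γ t 0 = 0 ∨ γ t 1 = 0}.ncard

/-- `γ'` is a reparametrization (time shift) of `γ`. -/
def IsTimeShift (γ γ' : ℝ → V4) : Prop := ∃ s : ℝ, ∀ t, γ' t = γ (t + s)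

/-- The action `𝒜(γ) = ∫₀ᵀ (w·ż - z·ẇ) dt` of a `T`-periodic Levi-Civita orbit. -/
def orbitAction (μ c T : ℝ) (γ : ℝ → V4) : ℝ :=
  ∫ t in (0:ℝ)..T,
    (γ t 2 * symplGrad (Kham μ c) (γ t) 0 + γ t 3 * symplGrad (Kham μ c) (γ t) 1
      - γ t 0 * symplGrad (Kham μ c) (γ t) 2 - γ t 1 * symplGrad (Kham μ c) (γ t) 3)

/-- Transverse non-degeneracy of a `T`-periodic orbit `γ` of `X_H` on a regular level set:
any `T`-periodic solution of the variational equation along `γ` starting tangent to the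
level set is a multiple of the Hamiltonian vector field. -/
def TransverseNondeg (H : V4 → ℝ) (T : ℝ) (γ : ℝ → V4) : Prop :=
  ∀ v : ℝ → V4,
    (∀ t : ℝ, HasDerivAt v (fderiv ℝ (symplGrad H) (γ t) (v t)) t) →
    v T = v 0 →
    fderiv ℝ H (γ 0) (v 0) = 0 →
    ∃ a : ℝ, v 0 = a • symplGrad H (γ 0)

/-- `T` is the minimal period of `γ`. -/
def IsMinimalPeriod (T : ℝ) (γ : ℝ → V4) : Prop :=
  0 < T ∧ (∀ t, γ (t + T) = γ t) ∧ ∀ T' : ℝ, 0 < T' → (∀ t, γ (t + T') = γ t) → T ≤ T'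

/-- The quaternionic matrix `I₄`. -/
def I4 : Matrix (Fin 4) (Fin 4) ℝ := !![0,0,1,0; 0,0,0,1; -1,0,0,0; 0,-1,0,0]

/-- The quaternionic matrix `J₄`. -/
def J4 : Matrix (Fin 4) (Fin 4) ℝ := !![0,1,0,0; -1,0,0,0; 0,0,0,-1; 0,0,1,0]

/-- The quaternionic matrix `K₄`. -/
def K4 : Matrix (Fin 4) (Fin 4) ℝ := !![0,0,0,-1; 0,0,1,0; 0,-1,0,0; 1,0,0,0]

/-- `Ω₂ = [[0,1],[-1,0]]`. -/
def Omega2 : M2 := !![0,1; -1,0]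

/-- `Ω₄ = -I₄`. -/
def Omega4 : Matrix (Fin 4) (Fin 4) ℝ := -I4

/-- The 4×2 frame matrix `F(x) = [U(x) V(x)]` with `U = J₄∇H/‖∇H‖`, `V = K₄∇H/‖∇H‖`. -/
def frameF (H : V4 → ℝ) (x : V4) : Matrix (Fin 4) (Fin 2) ℝ :=
  Matrix.of fun i j =>
    (if j = 0 then J4.mulVec (gradient4 H x) i else K4.mulVec (gradient4 H x) i)
      / enorm4 (gradient4 H x)

/-- `M` is the linearized flow `t ↦ dFl_t(γ(0))` along the orbit `γ` of `X_H`: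
`M(0) = id` and each column solves the variational equation. -/
def IsLinearizedFlow (H : V4 → ℝ) (γ : ℝ → V4) (M : ℝ → Matrix (Fin 4) (Fin 4) ℝ) : Prop :=
  M 0 = 1 ∧ ∀ j : Fin 4, ∀ t : ℝ,
    HasDerivAt (fun s => fun i => M s i j)
      (fderiv ℝ (symplGrad H) (γ t) (fun i => M t i j)) t

/-- The reduced monodromy path `Ψ(t) = Ω₂ᵀ F(γ(t))ᵀ Ω₄ M(t) F(γ(0))`. -/
def reducedMonodromy (H : V4 → ℝ) (γ : ℝ → V4)
    (M : ℝ → Matrix (Fin 4) (Fin 4) ℝ) (t : ℝ) : M2 :=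
  Omega2ᵀ * (frameF H (γ t))ᵀ * Omega4 * M t * frameF H (γ 0)

/-- The retraction `ρ(Ψ) = (ΨΨᵀ)^{-1/2}Ψ` of `SL(2,ℝ)` onto `SO(2)`, written explicitly. -/
def rho (Ψ : M2) : M2 :=
  (1 / Real.sqrt ((Ψ 0 0 + Ψ 1 1)^2 + (Ψ 0 1 - Ψ 1 0)^2)) •
    !![Ψ 0 0 + Ψ 1 1, Ψ 0 1 - Ψ 1 0; -(Ψ 0 1 - Ψ 1 0), Ψ 0 0 + Ψ 1 1]

/-- The rotation by angle `θ`. -/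
def rotMat (θ : ℝ) : M2 := !![Real.cos θ, -Real.sin θ; Real.sin θ, Real.cos θ]

/-- The Conley-Zehnder index of the path `ψ : [0,T] → SL(2,ℝ)` equals `k`: there is a
continuous angle `θ` with `θ(0) = 0` lifting `t ↦ ρ(ψ(t))`, and `k` is the even integer
closest to `θ(T)/π` if `tr ψ(T) > 2`, the odd integer closest to `θ(T)/π` if `tr ψ(T) < 2`. -/
def CZIndexIs (T : ℝ) (ψ : ℝ → M2) (k : ℤ) : Prop :=
  ∃ θ : ℝ → ℝ, ContinuousOn θ (Set.Icc 0 T) ∧ θ 0 = 0 ∧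
    (∀ t ∈ Set.Icc (0:ℝ) T, rho (ψ t) = rotMat (θ t)) ∧
    (((2:ℝ) < (ψ T).trace ∧ Even k) ∨ ((ψ T).trace < 2 ∧ Odd k)) ∧
    |θ T / Real.pi - (k:ℝ)| < 1

end

/-- A nonnegative interval `[lo, hi]` in fixed-point units of `2⁻¹⁴`. -/
structure Ival where
  lo : ℕ
  hi : ℕ

namespace Ival

def add (a b : Ival) : Ival := ⟨a.lo + b.lo, a.hi + b.hi⟩

/-- Truncated difference; encloses `x - y` whenever that difference is nonnegative. -/
def sub (a b : Ival) : Ival := ⟨a.lo - b.hi, a.hi - b.lo⟩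

def mul (a b : Ival) : Ival := ⟨a.lo * b.lo / 16384, a.hi * b.hi / 16384 + 1⟩

def smul (k : ℕ) (a : Ival) : Ival := ⟨k * a.lo, k * a.hi⟩

def half (a : Ival) : Ival := ⟨a.lo / 2, a.hi / 2 + 1⟩

/-- Reciprocal; meaningful when `0 < lo`. -/
def inv (a : Ival) : Ival := ⟨268435456 / a.hi, 268435456 / a.lo + 1⟩

def one : Ival := ⟨16384, 16384⟩

/-- Enclosure of the energies `[2.1, 2.1 + 10⁻⁶]`. -/
def energy : Ival := ⟨34406, 34407⟩

def left (a : Ival) : Ival := ⟨a.lo, (a.lo + a.hi) / 2⟩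

def right (a : Ival) : Ival := ⟨(a.lo + a.hi) / 2, a.hi⟩

def width (a : Ival) : ℕ := a.hi - a.lo

/-- Distance bound: encloses `|x - 1|` from above. -/
def distOne (a : Ival) : ℕ := (a.hi - 16384) + (16384 - a.lo)

end Ival

/-- A lower bound `pos - neg` in fixed-point units of `2⁻¹⁴`. -/
structure LowerBd where
  pos : ℕ
  neg : ℕ

namespace LowerBd

def add (a b : LowerBd) : LowerBd := ⟨a.pos + b.pos, a.neg + b.neg⟩

def diff (a b : Ival) : LowerBd := ⟨a.lo, b.hi⟩

def scale (x : Ival) (a : LowerBd) : LowerBd :=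
  ⟨x.lo * (a.pos - a.neg) / 16384, x.hi * (a.neg - a.pos) / 16384 + 1⟩

def lo (a : LowerBd) : ℕ := a.pos - a.neg

def up (a : LowerBd) : ℕ := a.neg - a.pos

end LowerBd

def mulUp (a b : ℕ) : ℕ := a * b / 16384 + 1

open Ival LowerBd in
/-- Interval test on a box of `(q, r, m)`: either the box contains no admissible point, or the
bordered Hessian determinant is positive on it. -/
def boxCheck (q r m : Ival) : Bool :=
  let q2 := mul q q
  let r2 := mul r r
  let p := add one q
  let p2 := mul p p
  let d := sub one q
  let d2 := mul d d
  let u := inv r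
  let A := add one (half (mul q2 q))
  let Zp := add A (half q)
  let Zm := mul q (add u (half (add r2 m)))
  let qc := mul q energy
  let Wlo := add (diff A qc) (scale m (diff Zm Zp))
  let Wup := add (diff qc A) (scale m (diff Zp Zm))
  let W : Ival := ⟨Wlo.lo, Wup.up⟩
  let u2 := mul u u
  let u3 := mul u2 u
  let y4 := mul (sub p2 r2) (sub r2 d2)
  let T : Ival := ⟨0, 6554 + 5 * (mul q W).hi⟩
  let e := sub one q2
  let k := smul 3 (mul u2 (mul e e))
  let q23 := smul 3 q2
  let c2 := smul 2 energy
  let Gbb := add (diff c2 (add q23 ⟨0, 5 * T.hi / 4 + 1⟩))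
    (scale m (add (scale u3 (diff k (add (smul 5 one) q23))) ⟨0, m.hi⟩))
  let Gaa := add (diff c2 (add (smul 15 q2) ⟨0, 13 * T.hi / 4 + 1⟩))
    (scale m (add (diff (smul 6 (add one q2)) (add (smul 6 r2) m))
      (scale u3 (diff (add one q23) k))))
  let vp := add (add (mul u3 e) u) (add (smul 2 r2) m)
  let vm := smul 2 (add one q2)
  let Llo := add (diff c2 q23) (scale m (diff vm vp))
  let Lup := add (diff q23 c2) (scale m (diff vp vm))
  let L : Ival := ⟨Llo.lo, Lup.up⟩
  let E := add ⟨(half (mul q (mul L L))).lo, 0⟩ (scale W Gaa)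
  let b := distOne u3
  let g := distOne (mul (mul u3 u2) e)
  let my := mul (mul m m) y4
  27 * 16384 < 50 * q.lo + 11 * m.lo || p2.hi < r2.lo || r2.hi < d2.lo || Wup.neg < Wup.pos ||
  0 < Llo.lo && 16384 * mulUp my.hi (mulUp q.hi (3 * mulUp (mulUp L.hi b) g + mulUp (mulUp b b) Gaa.up)
      + 9 * mulUp (mulUp W.hi g) g) < Gbb.lo * E.lo

open Ival in
/-- Bisects a box until `boxCheck` succeeds on every piece. -/
def boxSearch : ℕ → Ival → Ival → Ival → Bool
  | 0, _, _, _ => false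
  | n + 1, q, r, m =>
    boxCheck q r m ||
      if 3 * width r ≤ 4 * width q ∧ width m ≤ 4 * width q then
        boxSearch n q.left r m && boxSearch n q.right r m
      else if width m ≤ 3 * width r then
        boxSearch n q r.left m && boxSearch n q r.right m
      else
        boxSearch n q r m.left && boxSearch n q r m.right

namespace Ival

/-- The real number `x` lies in the interval `I`. -/
def Contains (I : Ival) (x : ℝ) : Prop := (I.lo : ℝ) ≤ x * 16384 ∧ x * 16384 ≤ I.hi

theorem Contains.nonneg {I : Ival} {x : ℝ} (h : I.Contains x) : 0 ≤ x := by
  have h0 : (0 : ℝ) ≤ I.lo := Nat.cast_nonneg _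
  linarith [h.1]

theorem contains_one : one.Contains 1 := by
  constructor <;> norm_num [one]

theorem contains_energy {c : ℝ} (hc : c ∈ Set.Icc (2.1 : ℝ) (2.1 + 1 / 1000000)) :
    energy.Contains c := by
  obtain ⟨h1, h2⟩ := hc
  constructor <;> norm_num [energy] <;> norm_num at h1 h2 <;> linarith

theorem Contains.add {I J : Ival} {x y : ℝ} (hx : I.Contains x) (hy : J.Contains y) :
    (I.add J).Contains (x + y) := by
  constructor <;> simp only [Ival.add, Nat.cast_add] <;> linarith [hx.1, hx.2, hy.1, hy.2]

theorem cast_tsub_le {a b : ℕ} {t : ℝ} (h : (a : ℝ) - b ≤ t) (ht : 0 ≤ t) :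
    ((a - b : ℕ) : ℝ) ≤ t := by
  rcases le_total b a with hab | hab
  · rwa [Nat.cast_sub hab]
  · rwa [Nat.sub_eq_zero_of_le hab, Nat.cast_zero]

theorem le_cast_tsub {a b : ℕ} {t : ℝ} (h : t ≤ (a : ℝ) - b) : t ≤ ((a - b : ℕ) : ℝ) :=
  h.trans (by rw [sub_le_iff_le_add]; exact_mod_cast le_tsub_add)

theorem Contains.sub {I J : Ival} {x y : ℝ} (hx : I.Contains x) (hy : J.Contains y)
    (hxy : y ≤ x) : (I.sub J).Contains (x - y) :=
  ⟨cast_tsub_le (by linarith [hx.1, hy.2]) (by linarith),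
    le_cast_tsub (by linarith [hx.2, hy.1])⟩

theorem cast_div_le_of_le {a k : ℕ} {t : ℝ} (hk : 0 < k) (h : (a : ℝ) ≤ t * k) :
    ((a / k : ℕ) : ℝ) ≤ t :=
  Nat.cast_div_le.trans ((div_le_iff₀ (by exact_mod_cast hk)).2 h)

theorem le_cast_div_add_one {a k : ℕ} {t : ℝ} (hk : 0 < k) (h : t * k ≤ a) :
    t ≤ ((a / k + 1 : ℕ) : ℝ) := by
  have hk' : (0 : ℝ) < k := by exact_mod_cast hk
  have h1 : (a : ℝ) ≤ k * (a / k + 1 : ℕ) := by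
    exact_mod_cast (Nat.lt_mul_div_succ a hk).le
  exact le_of_mul_le_mul_right (by linarith) hk'

end Ival

theorem le_mulUp {a b : ℕ} {x y : ℝ} (hy0 : 0 ≤ y) (hx : x * 16384 ≤ a)
    (hy : y * 16384 ≤ b) : x * y * 16384 ≤ mulUp a b := by
  refine Ival.le_cast_div_add_one (by norm_num) ?_
  push_cast
  calc x * y * 16384 * 16384 = (x * 16384) * (y * 16384) := by ring
    _ ≤ a * b := mul_le_mul hx hy (by positivity) (Nat.cast_nonneg _)

namespace Ival

theorem Contains.mul {I J : Ival} {x y : ℝ} (hx : I.Contains x) (hy : J.Contains y) :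
    (I.mul J).Contains (x * y) := by
  refine ⟨cast_div_le_of_le (by norm_num) ?_, le_mulUp hy.nonneg hx.2 hy.2⟩
  push_cast
  calc (I.lo * J.lo : ℝ) ≤ (x * 16384) * (y * 16384) :=
        mul_le_mul hx.1 hy.1 (Nat.cast_nonneg _) (by linarith [hx.nonneg])
    _ = x * y * 16384 * 16384 := by ring

theorem Contains.smul {I : Ival} {x : ℝ} (k : ℕ) (hx : I.Contains x) :
    (I.smul k).Contains (k * x) := by
  have hk : (0 : ℝ) ≤ k := Nat.cast_nonneg _
  constructor <;> simp only [Ival.smul, Nat.cast_mul, mul_assoc]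
  · exact mul_le_mul_of_nonneg_left hx.1 hk
  · exact mul_le_mul_of_nonneg_left hx.2 hk

theorem Contains.half {I : Ival} {x : ℝ} (hx : I.Contains x) : I.half.Contains (x / 2) := by
  constructor
  · exact cast_div_le_of_le (by norm_num) (by push_cast; linarith [hx.1])
  · exact le_cast_div_add_one (by norm_num) (by push_cast; linarith [hx.2])

theorem Contains.inv {I : Ival} {x : ℝ} (hx : I.Contains x) (h : 0 < I.lo) :
    I.inv.Contains x⁻¹ := by
  have hlo : (0 : ℝ) < I.lo := by exact_mod_cast h
  have hx0 : 0 < x := by linarith [hx.1]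
  have hhi : 0 < I.hi := by
    have : (0 : ℝ) < I.hi := by linarith [hx.1, hx.2]
    exact_mod_cast this
  constructor
  · refine cast_div_le_of_le hhi ?_
    have := mul_le_mul_of_nonneg_left hx.2 (inv_nonneg.2 hx0.le)
    rw [← mul_assoc, inv_mul_cancel₀ hx0.ne'] at this
    push_cast
    linarith
  · refine le_cast_div_add_one h ?_
    have := mul_le_mul_of_nonneg_left hx.1 (inv_nonneg.2 hx0.le)
    rw [← mul_assoc, inv_mul_cancel₀ hx0.ne'] at this
    push_cast
    linarith

theorem Contains.abs_sub_one_le {I : Ival} {x : ℝ} (hx : I.Contains x) :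
    |x - 1| * 16384 ≤ I.distOne := by
  have h1 : x * 16384 - 16384 ≤ ((I.hi - 16384 : ℕ) : ℝ) :=
    le_cast_tsub (by push_cast; linarith [hx.2])
  have h2 : 16384 - x * 16384 ≤ ((16384 - I.lo : ℕ) : ℝ) :=
    le_cast_tsub (by push_cast; linarith [hx.1])
  have h3 : (0 : ℝ) ≤ ((I.hi - 16384 : ℕ) : ℝ) := Nat.cast_nonneg _
  have h4 : (0 : ℝ) ≤ ((16384 - I.lo : ℕ) : ℝ) := Nat.cast_nonneg _
  rw [distOne, Nat.cast_add]
  rcases abs_cases (x - 1) with ⟨h, _⟩ | ⟨h, _⟩ <;> rw [h] <;> linarith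

theorem Contains.left_or_right {I : Ival} {x : ℝ} (hx : I.Contains x) :
    I.left.Contains x ∨ I.right.Contains x :=
  (le_total (x * 16384) (((I.lo + I.hi) / 2 : ℕ) : ℝ)).imp
    (fun h => ⟨hx.1, h⟩) (fun h => ⟨h, hx.2⟩)

theorem Contains.lo_le_right_lo {I : Ival} {x : ℝ} (hx : I.Contains x) :
    I.lo ≤ I.right.lo := by
  have : I.lo ≤ I.hi := by exact_mod_cast hx.1.trans hx.2
  simp only [right]
  omega

end Ival

namespace LowerBd

/-- The bound `a` is a valid lower bound for `x`. -/
def Bounds (a : LowerBd) (x : ℝ) : Prop := (a.pos : ℝ) - a.neg ≤ x * 16384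

theorem Bounds.add {a b : LowerBd} {x y : ℝ} (hx : a.Bounds x) (hy : b.Bounds y) :
    (a.add b).Bounds (x + y) := by
  simp only [Bounds, LowerBd.add, Nat.cast_add] at *
  linarith

theorem bounds_diff {I J : Ival} {x y : ℝ} (hx : I.Contains x) (hy : J.Contains y) :
    (diff I J).Bounds (x - y) := by
  simp only [Bounds, diff]
  linarith [hx.1, hy.2]

theorem bounds_neg_of_le {n : ℕ} {x : ℝ} (hx : x * 16384 ≤ n) :
    (⟨0, n⟩ : LowerBd).Bounds (-x) := by
  simp only [Bounds, Nat.cast_zero]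
  linarith

theorem Bounds.lo_le {a : LowerBd} {x : ℝ} (h : a.Bounds x) (hx : 0 ≤ x) :
    (a.lo : ℝ) ≤ x * 16384 :=
  Ival.cast_tsub_le h (by positivity)

theorem Bounds.le_up {a : LowerBd} {x : ℝ} (h : a.Bounds (-x)) : x * 16384 ≤ a.up :=
  Ival.le_cast_tsub (by simp only [Bounds] at h; linarith)

theorem Bounds.lo_le_of_pos {a : LowerBd} {x : ℝ} (h : a.Bounds x) (hp : 0 < a.lo) :
    (a.lo : ℝ) ≤ x * 16384 := by
  simp only [lo] at *
  rw [Nat.cast_sub (by omega)]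
  exact h

theorem Bounds.scale {I : Ival} {a : LowerBd} {x y : ℝ} (hx : I.Contains x)
    (hy : a.Bounds y) : (scale I a).Bounds (x * y) := by
  simp only [Bounds, LowerBd.scale] at *
  have hx0 := hx.nonneg
  rcases le_total a.neg a.pos with h | h
  · have h1 : ((I.lo * (a.pos - a.neg) / 16384 : ℕ) : ℝ) ≤ x * y * 16384 := by
      refine Ival.cast_div_le_of_le (by norm_num) ?_
      push_cast [Nat.cast_sub h]
      have h0 : (0 : ℝ) ≤ (a.pos : ℝ) - a.neg := sub_nonneg.2 (by exact_mod_cast h)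
      calc (I.lo : ℝ) * (a.pos - a.neg) ≤ (x * 16384) * (y * 16384) :=
            mul_le_mul hx.1 hy h0 (by positivity)
        _ = x * y * 16384 * 16384 := by ring
    have h2 : (0 : ℝ) ≤ ((I.hi * (a.neg - a.pos) / 16384 + 1 : ℕ) : ℝ) := Nat.cast_nonneg _
    linarith
  · have h1 : -(x * y) * 16384 ≤ ((I.hi * (a.neg - a.pos) / 16384 + 1 : ℕ) : ℝ) := by
      refine Ival.le_cast_div_add_one (by norm_num) ?_
      push_cast [Nat.cast_sub h]
      have h0 : (0 : ℝ) ≤ (a.neg : ℝ) - a.pos := sub_nonneg.2 (by exact_mod_cast h)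
      calc -(x * y) * 16384 * 16384 = (x * 16384) * (-(y * 16384)) := by ring
        _ ≤ (x * 16384) * (a.neg - a.pos) :=
            mul_le_mul_of_nonneg_left (by linarith) (by positivity)
        _ ≤ I.hi * (a.neg - a.pos) := mul_le_mul_of_nonneg_right hx.2 h0
    have h2 : I.lo * (a.pos - a.neg) / 16384 = 0 := by
      rw [Nat.sub_eq_zero_of_le h]; simp
    rw [h2]
    push_cast at h1 ⊢
    linarith

end LowerBd

/-! In the variables `q = |Q|` and `r = |Q - 1|`, where `Q = 2z²`, with `u = 1 / r`. -/

/-- Twice the effective potential, i.e. `|w + b(z)|²` on the energy hypersurface. -/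
noncomputable def hillW (c q r m : ℝ) : ℝ :=
  (1 + q * q * q / 2 - q * c) -
    m * ((1 + q * q * q / 2 + q / 2) - q * (r⁻¹ + (r * r + m) / 2))

/-- Upper bound for the size of the magnetic term relative to the Hessian. -/
noncomputable def magT (c q r m : ℝ) : ℝ := 2 / 5 + 5 * (q * hillW c q r m)

noncomputable def quadTan (c q r m : ℝ) : ℝ :=
  2 * c - (3 * (q * q) + 5 / 4 * magT c q r m) +
    m * ((r⁻¹ * r⁻¹ * r⁻¹) * (3 * (r⁻¹ * r⁻¹ * ((1 - q * q) * (1 - q * q))) -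
      (5 * 1 + 3 * (q * q))) - m)

noncomputable def quadRad (c q r m : ℝ) : ℝ :=
  2 * c - (15 * (q * q) + 13 / 4 * magT c q r m) +
    m * ((6 * (1 + q * q) - (6 * (r * r) + m)) +
      (r⁻¹ * r⁻¹ * r⁻¹) * ((1 + 3 * (q * q)) -
        3 * (r⁻¹ * r⁻¹ * ((1 - q * q) * (1 - q * q)))))

/-- Minus the radial logarithmic derivative of the effective potential. -/
noncomputable def slopeRad (c q r m : ℝ) : ℝ :=
  (2 * c - 3 * (q * q)) +
    m * (2 * (1 + q * q) - (r⁻¹ * r⁻¹ * r⁻¹ * (1 - q * q) + r⁻¹ + (2 * (r * r) + m)))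

/-- The triangle `0, 1, Q` has sixteen times squared area `heron q r`. -/
noncomputable def heron (q r : ℝ) : ℝ := ((1 + q) * (1 + q) - r * r) * (r * r - (1 - q) * (1 - q))

/-- Determinant governing convexity. -/
noncomputable def convDet (c q r m : ℝ) : ℝ :=
  quadTan c q r m * (q * (slopeRad c q r m * slopeRad c q r m) / 2 +
      hillW c q r m * quadRad c q r m) +
    (m * m * heron q r) *
      (q / 2 * (6 * slopeRad c q r m * (1 - r⁻¹ * r⁻¹ * r⁻¹) *
            (r⁻¹ * r⁻¹ * r⁻¹ * (r⁻¹ * r⁻¹) * (1 - q * q) - 1) +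
          (1 - r⁻¹ * r⁻¹ * r⁻¹) ^ 2 * quadRad c q r m) -
        9 * hillW c q r m * (r⁻¹ * r⁻¹ * r⁻¹ * (r⁻¹ * r⁻¹) * (1 - q * q) - 1) ^ 2)

/-- The configurations with `q` and `r` admissible, of nonnegative kinetic energy, on the
near side of the neck. -/
structure Admissible (c q r m : ℝ) : Prop where
  neck : 50 * q + 11 * m ≤ 27
  lower : (1 - q) * (1 - q) ≤ r * r
  upper : r * r ≤ (1 + q) * (1 + q)
  hill : 0 ≤ hillW c q r m

open Ival LowerBd in
theorem boxCheck_sound {I J K : Ival} {c q r m : ℝ} (h : boxCheck I J K = true)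
    (hc : energy.Contains c) (hq : I.Contains q) (hr : J.Contains r) (hm : K.Contains m)
    (hJ : 0 < J.lo) (H : Admissible c q r m) :
    0 < quadTan c q r m ∧ 0 < convDet c q r m := by
  obtain ⟨hneck, hlow, hupp, hW0⟩ := H
  unfold boxCheck at h
  extract_lets q2 r2 p p2 d d2 u A Zp Zm qc Wlo Wup W u2 u3 y4 T e k q23 c2 Gbb Gaa vp vm Llo Lup
    L E b g my at h
  have hq0 := hq.nonneg
  have hm0 := hm.nonneg
  have hq1 : q ≤ 1 := by linarith
  have hu : u.Contains r⁻¹ := hr.inv hJ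
  have hq2 : q2.Contains (q * q) := hq.mul hq
  have hr2 : r2.Contains (r * r) := hr.mul hr
  have hA : A.Contains (1 + q * q * q / 2) := contains_one.add (hq2.mul hq).half
  have hZp : Zp.Contains (1 + q * q * q / 2 + q / 2) := hA.add hq.half
  have hZm : Zm.Contains (q * (r⁻¹ + (r * r + m) / 2)) := hq.mul (hu.add (hr2.add hm).half)
  have hqc : qc.Contains (q * c) := hq.mul hc
  have hWlo : Wlo.Bounds (hillW c q r m) := by
    convert (bounds_diff hA hqc).add ((bounds_diff hZm hZp).scale hm) using 1
    unfold hillW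
    ring
  have hWup : Wup.Bounds (-hillW c q r m) := by
    convert (bounds_diff hqc hA).add ((bounds_diff hZp hZm).scale hm) using 1
    unfold hillW
    ring
  have hW : W.Contains (hillW c q r m) := ⟨hWlo.lo_le hW0, hWup.le_up⟩
  have hu2 : u2.Contains (r⁻¹ * r⁻¹) := hu.mul hu
  have hu3 : u3.Contains (r⁻¹ * r⁻¹ * r⁻¹) := hu2.mul hu
  have hp : p.Contains (1 + q) := contains_one.add hq
  have hd : d.Contains (1 - q) := contains_one.sub hq hq1
  have hp2 : p2.Contains _ := hp.mul hp
  have hd2 : d2.Contains _ := hd.mul hd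
  have hy4 : y4.Contains (heron q r) := (hp2.sub hr2 hupp).mul (hr2.sub hd2 hlow)
  have he : e.Contains (1 - q * q) := contains_one.sub hq2 (by nlinarith)
  have hk : k.Contains _ := (hu2.mul (he.mul he)).smul 3
  have hq23 : q23.Contains _ := hq2.smul 3
  have hc2 : c2.Contains _ := hc.smul 2
  have hvp : vp.Contains _ := ((hu3.mul he).add hu).add ((hr2.smul 2).add hm)
  have hvm : vm.Contains _ := (contains_one.add hq2).smul 2
  have hLlo : Llo.Bounds (slopeRad c q r m) := by
    convert (bounds_diff hc2 hq23).add ((bounds_diff hvm hvp).scale hm) using 1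
    push_cast [slopeRad]
    ring
  have hLup : Lup.Bounds (-slopeRad c q r m) := by
    convert (bounds_diff hq23 hc2).add ((bounds_diff hvp hvm).scale hm) using 1
    push_cast [slopeRad]
    ring
  have hT : magT c q r m * 16384 ≤ T.hi := by
    have h1 := (hq.mul hW).2
    simp only [T, magT]
    push_cast
    linarith
  have hT0 : 0 ≤ magT c q r m := by unfold magT; positivity
  have hGbb : Gbb.Bounds (quadTan c q r m) := by
    have h1 : (5 / 4 * magT c q r m) * 16384 ≤ ((5 * T.hi / 4 + 1 : ℕ) : ℝ) :=
      le_cast_div_add_one (by norm_num) (by push_cast; linarith)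
    have h2 : (⟨0, 5 * T.hi / 4 + 1⟩ : Ival).Contains (5 / 4 * magT c q r m) :=
      ⟨by simpa using hT0, h1⟩
    convert (bounds_diff hc2 (hq23.add h2)).add ((((bounds_diff hk
      ((contains_one.smul 5).add hq23)).scale hu3).add (bounds_neg_of_le hm.2)).scale hm) using 1
    push_cast [quadTan]
    ring
  have hGaa : Gaa.Bounds (quadRad c q r m) := by
    have h1 : (13 / 4 * magT c q r m) * 16384 ≤ ((13 * T.hi / 4 + 1 : ℕ) : ℝ) :=
      le_cast_div_add_one (by norm_num) (by push_cast; linarith)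
    have h2 : (⟨0, 13 * T.hi / 4 + 1⟩ : Ival).Contains (13 / 4 * magT c q r m) :=
      ⟨by simpa using hT0, h1⟩
    convert (bounds_diff hc2 ((hq2.smul 15).add h2)).add (((bounds_diff
      ((contains_one.add hq2).smul 6) ((hr2.smul 6).add hm)).add
        ((bounds_diff (contains_one.add hq23) hk).scale hu3)).scale hm) using 1
    push_cast [quadRad]
    ring
  simp only [Bool.or_eq_true, Bool.and_eq_true, decide_eq_true_eq] at h
  rcases h with (((h | h) | h) | h) | ⟨hL0, h⟩
  · have h1 : (27 * 16384 : ℝ) < 50 * I.lo + 11 * K.lo := by exact_mod_cast h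
    linarith [hq.1, hm.1]
  · have h1 : (p2.hi : ℝ) < r2.lo := by exact_mod_cast h
    linarith [hp2.2, hr2.1]
  · have h1 : (r2.hi : ℝ) < d2.lo := by exact_mod_cast h
    linarith [hr2.2, hd2.1]
  · have h1 : (Wup.neg : ℝ) < Wup.pos := by exact_mod_cast h
    simp only [LowerBd.Bounds] at hWup
    linarith
  have hpos : 0 < Gbb.lo * E.lo := by omega
  have hGpos : 0 < Gbb.lo := Nat.pos_of_mul_pos_right hpos
  have hEpos : 0 < E.lo := Nat.pos_of_mul_pos_left hpos
  have hΛ := hLlo.lo_le_of_pos hL0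
  have hΛ0 : 0 < slopeRad c q r m := by
    have : (0 : ℝ) < Llo.lo := by exact_mod_cast hL0
    linarith
  have hL : L.Contains (slopeRad c q r m) := ⟨hΛ, hLup.le_up⟩
  have hE : E.Bounds (q * (slopeRad c q r m * slopeRad c q r m) / 2 +
      hillW c q r m * quadRad c q r m) := by
    refine LowerBd.Bounds.add ?_ (hGaa.scale hW)
    have := (hq.mul (hL.mul hL)).half.1
    simpa [LowerBd.Bounds] using this
  have hG1 := hGbb.lo_le_of_pos hGpos
  have hE1 := hE.lo_le_of_pos hEpos
  have hG0 : 0 < quadTan c q r m := by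
    have : (0 : ℝ) < Gbb.lo := by exact_mod_cast hGpos
    linarith
  refine ⟨hG0, ?_⟩
  have hy0 := hy4.nonneg
  have hAn : max 0 (-quadRad c q r m) * 16384 ≤ Gaa.up := by
    rw [max_mul_of_nonneg _ _ (by norm_num)]
    refine max_le (by simp) ?_
    exact LowerBd.Bounds.le_up (by simpa using hGaa)
  have hb := hu3.abs_sub_one_le
  have hg := ((hu3.mul hu2).mul he).abs_sub_one_le
  have hmy : my.Contains _ := (hm.mul hm).mul hy4
  set β := |r⁻¹ * r⁻¹ * r⁻¹ - 1| with hβ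
  set γ := |r⁻¹ * r⁻¹ * r⁻¹ * (r⁻¹ * r⁻¹) * (1 - q * q) - 1| with hγ
  set N := max 0 (-quadRad c q r m)
  have hN0 : 0 ≤ N := le_max_left _ _
  have hN1 : -quadRad c q r m ≤ N := le_max_right _ _
  have hβ0 : 0 ≤ β := abs_nonneg _
  have hγ0 : 0 ≤ γ := abs_nonneg _
  have k1 := le_mulUp hγ0 (le_mulUp hβ0 hL.2 hb) hg
  have k2 := le_mulUp hN0 (le_mulUp hβ0 hb hb) hAn
  have k3 := le_mulUp hγ0 (le_mulUp hγ0 hW.2 hg) hg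
  have k4 : (q * (3 * (slopeRad c q r m * β * γ) + β * β * N)) * 16384 ≤ _ :=
    le_mulUp (by positivity) hq.2
      (b := 3 * mulUp (mulUp L.hi b) g + mulUp (mulUp b b) Gaa.up) (by push_cast; linarith)
  have k5 : (m * m * heron q r) * (q * (3 * (slopeRad c q r m * β * γ) + β * β * N) +
      9 * (hillW c q r m * γ * γ)) * 16384 ≤ _ :=
    le_mulUp (by positivity) hmy.2
      (b := mulUp I.hi (3 * mulUp (mulUp L.hi b) g + mulUp (mulUp b b) Gaa.up) +
        9 * mulUp (mulUp W.hi g) g) (by push_cast at k4 ⊢; linarith)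
  have k6 := Nat.cast_lt (α := ℝ).2 h
  rw [Nat.cast_mul, Nat.cast_mul, Nat.cast_ofNat] at k6
  have k7 := mul_le_mul hG1 hE1 (Nat.cast_nonneg _) (by positivity)
  have hβγ : -(β * γ) ≤ (1 - r⁻¹ * r⁻¹ * r⁻¹) *
      (r⁻¹ * r⁻¹ * r⁻¹ * (r⁻¹ * r⁻¹) * (1 - q * q) - 1) := by
    rw [hβ, hγ, abs_sub_comm _ 1, ← abs_mul]
    exact neg_abs_le _
  have hβ2 : β * β = (1 - r⁻¹ * r⁻¹ * r⁻¹) ^ 2 := by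
    rw [hβ, abs_mul_abs_self]
    ring
  have hγ2 : γ * γ = (r⁻¹ * r⁻¹ * r⁻¹ * (r⁻¹ * r⁻¹) * (1 - q * q) - 1) ^ 2 := by
    rw [hγ, abs_mul_abs_self]
    ring
  have hcross := mul_le_mul_of_nonneg_left hβγ hΛ0.le
  have hrad := mul_le_mul_of_nonneg_left hN1 (mul_nonneg hβ0 hβ0)
  have hββN : 0 ≤ β * β * N := by positivity
  have hmix := mul_le_mul_of_nonneg_left (by linarith :
    -(3 * (slopeRad c q r m * β * γ) + β * β * N) ≤
      3 * (slopeRad c q r m * ((1 - r⁻¹ * r⁻¹ * r⁻¹) *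
        (r⁻¹ * r⁻¹ * r⁻¹ * (r⁻¹ * r⁻¹) * (1 - q * q) - 1))) +
      β * β * quadRad c q r m / 2) hq0
  have hfin := mul_le_mul_of_nonneg_left hmix hmy.nonneg
  have hdet : convDet c q r m = quadTan c q r m * (q * (slopeRad c q r m * slopeRad c q r m) / 2 +
      hillW c q r m * quadRad c q r m) + m * m * heron q r *
      (q * (3 * (slopeRad c q r m * ((1 - r⁻¹ * r⁻¹ * r⁻¹) *
        (r⁻¹ * r⁻¹ * r⁻¹ * (r⁻¹ * r⁻¹) * (1 - q * q) - 1))) +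
        β * β * quadRad c q r m / 2)) - m * m * heron q r * (9 * (hillW c q r m * (γ * γ))) := by
    rw [hβ2, hγ2, convDet]
    ring
  rw [hdet]
  clear_value β γ N
  linarith only [k5, k6, k7, hfin]

open Ival in
theorem boxSearch_sound {c q r m : ℝ} (hc : energy.Contains c) (H : Admissible c q r m) (n : ℕ) :
    ∀ I J K : Ival, boxSearch n I J K = true → I.Contains q → J.Contains r → K.Contains m →
      0 < J.lo → 0 < quadTan c q r m ∧ 0 < convDet c q r m := by
  induction n with
  | zero => simp [boxSearch]
  | succ n ih =>
    intro I J K h hq hr hm hJ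
    rw [boxSearch, Bool.or_eq_true] at h
    rcases h with h | h
    · exact boxCheck_sound h hc hq hr hm hJ H
    · have hJ' : 0 < J.right.lo := hJ.trans_le hr.lo_le_right_lo
      split_ifs at h <;> rw [Bool.and_eq_true] at h
      · exact hq.left_or_right.elim (ih _ _ _ h.1 · hr hm hJ) (ih _ _ _ h.2 · hr hm hJ)
      · exact hr.left_or_right.elim (ih _ _ _ h.1 hq · hm hJ) (ih _ _ _ h.2 hq · hm hJ')
      · exact hm.left_or_right.elim (ih _ _ _ h.1 hq hr · hJ) (ih _ _ _ h.2 hq hr · hJ)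

theorem boxSearch_certificate :
    boxSearch 22 ⟨0, 9216⟩ ⟨7168, 25600⟩ ⟨0, 8192⟩ = true := by
  decide +kernel

/-- Positivity of the tangential quadratic form and of the convexity determinant. -/
theorem Admissible.pos {c q r m : ℝ} (H : Admissible c q r m)
    (hc : c ∈ Set.Icc (2.1 : ℝ) (2.1 + 1 / 1000000)) (hm : m ∈ Set.Icc (0 : ℝ) (1 / 2))
    (hq : 0 ≤ q) (hr : 0 ≤ r) : 0 < quadTan c q r m ∧ 0 < convDet c q r m := by
  obtain ⟨hm0, hm1⟩ := hm
  have hneck := H.neck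
  have h1 : 1 - q ≤ r := abs_le_of_sq_le_sq' (by nlinarith [H.lower]) hr |>.2
  have h2 : r ≤ 1 + q := abs_le_of_sq_le_sq' (by nlinarith [H.upper]) (by linarith) |>.2
  refine boxSearch_sound (Ival.contains_energy hc) H 22 _ _ _ boxSearch_certificate
    ⟨?_, ?_⟩ ⟨?_, ?_⟩ ⟨?_, ?_⟩ ?_ <;> norm_num <;> linarith

/-- The neck is a barrier: the effective potential is negative there. -/
theorem hillW_neg_of_neck {c q r m : ℝ} (hc : 2.1 ≤ c) (hm : m ∈ Set.Icc (0 : ℝ) (1 / 2))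
    (hq : 50 * q + 11 * m = 27) (h1 : 1 - q ≤ r) (h2 : r ≤ 1 + q) : hillW c q r m < 0 := by
  obtain ⟨hm0, hm1⟩ := hm
  have hq1 : q ≤ 27 / 50 := by linarith
  have hq2 : 43 / 100 ≤ q := by linarith
  have hr : 0 < r := by linarith
  have hd : 0 < 1 - q := by linarith
  have key : r⁻¹ + r * r / 2 ≤ (1 - q)⁻¹ + (1 - q) * (1 - q) / 2 := by
    have h3 : (r + (1 - q)) * r * (1 - q) ≤ 2 := by nlinarith [mul_nonneg hr.le hd.le]
    have h4 : (1 - q)⁻¹ - r⁻¹ = (r - (1 - q)) * (r⁻¹ * (1 - q)⁻¹) := by field_simp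
    have h5 : (r + (1 - q)) / 2 ≤ r⁻¹ * (1 - q)⁻¹ := by
      rw [← mul_inv, le_inv_comm₀ (by positivity) (by positivity), inv_div,
        le_div_iff₀ (by positivity)]
      linarith
    nlinarith [mul_le_mul_of_nonneg_left h5 (sub_nonneg.2 h1)]
  have h6 : (1 - q) * (1 - q)⁻¹ = 1 := mul_inv_cancel₀ hd.ne'
  have h7 := mul_le_mul_of_nonneg_left key (mul_nonneg hm0 (by linarith : 0 ≤ q))
  have h8 : q * 2.1 ≤ q * c := by nlinarith
  have h9 : hillW c q r m ≤ (1 + q * q * q / 2 - q * 2.1) - m * (1 + q * q * q / 2 + q / 2) +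
      m * q * ((1 - q)⁻¹ + (1 - q) * (1 - q) / 2) + m * m * q / 2 := by
    unfold hillW
    nlinarith
  refine h9.trans_lt ?_
  obtain ⟨s, rfl⟩ : ∃ s, q = s + 43 / 100 := ⟨q - 43 / 100, by ring⟩
  obtain rfl : m = (27 - 50 * (s + 43 / 100)) / 11 := by linarith
  set t := (1 - (s + 43 / 100))⁻¹
  refine neg_of_mul_neg_right (a := 1 - (s + 43 / 100)) ?_ hd.le
  have hs : 0 ≤ s := by linarith
  have hs3 : s * s * s ≤ 11 / 100 * (s * s) := by nlinarith [mul_self_nonneg s]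
  have hs4 : 0 ≤ s * s * (s * s) := by positivity
  have hs2 := sq_nonneg (s - 1 / 25)
  have h10 : (27 - 50 * (s + 43 / 100)) / 11 * (s + 43 / 100) * ((1 - (s + 43 / 100)) * t) =
      (27 - 50 * (s + 43 / 100)) / 11 * (s + 43 / 100) := by rw [h6, mul_one]
  nlinarith only [h10, hs3, hs4, hs2]

/-! The Levi-Civita Hamiltonian as kinetic minus effective potential energy. -/

/-- `|Q| = |2z²|`. -/
def levi (x : V4) : ℝ := 2 * ((x 0) ^ 2 + (x 1) ^ 2)

theorem levi_nonneg (x : V4) : 0 ≤ levi x := by unfold levi; positivity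

/-- The first component of the mechanical momentum `w + b(z)`. -/
def mom₁ (μ : ℝ) (x : V4) : ℝ := x 2 - (levi x + μ) * x 1

/-- The second component of the mechanical momentum `w + b(z)`. -/
def mom₂ (μ : ℝ) (x : V4) : ℝ := x 3 + (levi x - μ) * x 0

theorem lcAbs_nonneg (a b : ℝ) : 0 ≤ lcAbs a b := Real.sqrt_nonneg _

theorem lcAbs_mul_self (a b : ℝ) :
    lcAbs a b * lcAbs a b = (2 * (a ^ 2 - b ^ 2) - 1) ^ 2 + (4 * a * b) ^ 2 :=
  Real.mul_self_sqrt (by positivity)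

theorem two_mul_Kham (μ c : ℝ) (x : V4) :
    2 * Kham μ c x = mom₁ μ x ^ 2 + mom₂ μ x ^ 2 -
      hillW c (levi x) (lcAbs (x 0) (x 1)) μ := by
  have h := lcAbs_mul_self (x 0) (x 1)
  simp only [hillW, h, Kham, mom₁, mom₂, levi, div_eq_mul_inv]
  ring

theorem lcAbs_lower (x : V4) :
    (1 - levi x) * (1 - levi x) ≤ lcAbs (x 0) (x 1) * lcAbs (x 0) (x 1) := by
  rw [lcAbs_mul_self, levi]
  nlinarith [sq_nonneg (x 1)]

theorem lcAbs_upper (x : V4) :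
    lcAbs (x 0) (x 1) * lcAbs (x 0) (x 1) ≤ (1 + levi x) * (1 + levi x) := by
  rw [lcAbs_mul_self, levi]
  nlinarith [sq_nonneg (x 0)]

theorem continuous_levi : Continuous levi := by
  unfold levi
  fun_prop

/-- The component `Σ_{μ,c}` stays on the near side of the neck. -/
theorem neck_of_mem_SigmaLC {μ c : ℝ} (hμ : μ ∈ Set.Icc (0 : ℝ) (1 / 2)) (hc : 2.1 ≤ c)
    {x : V4} (hx : x ∈ SigmaLC μ c) : 50 * levi x + 11 * μ ≤ 27 := by
  unfold SigmaLC at hx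
  set S := {x : V4 | x ∈ LCDom ∧ Kham μ c x = 0}
  set e : V4 := ![0, 0, Real.sqrt (1 - μ), 0]
  have he : e ∈ S := connectedComponentIn_nonempty_iff.1 ⟨x, hx⟩
  have hne : ∀ y ∈ S, 50 * levi y + 11 * μ ≠ 27 := by
    rintro y ⟨hy, hK⟩ hB
    have hW := hillW_neg_of_neck (r := lcAbs (y 0) (y 1)) hc hμ hB
      (abs_le_of_sq_le_sq' (by nlinarith [lcAbs_lower y]) (lcAbs_nonneg _ _)).2
      (abs_le_of_sq_le_sq' (by nlinarith [lcAbs_upper y]) (by linarith [levi_nonneg y])).2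
    have := two_mul_Kham μ c y
    rw [hK] at this
    nlinarith [sq_nonneg (mom₁ μ y), sq_nonneg (mom₂ μ y)]
  by_contra! hlt
  have he0 : levi e = 0 := by simp [levi, e]
  obtain ⟨y, hy, hB⟩ := isPreconnected_connectedComponentIn.intermediate_value
    (mem_connectedComponentIn he) hx (f := fun y => 50 * levi y + 11 * μ)
    (by have := continuous_levi; fun_prop)
    ⟨by simp only [he0]; linarith [hμ.2], hlt.le⟩
  exact hne y (connectedComponentIn_subset S e hy) hB

theorem admissible_of_mem_SigmaLC {μ c : ℝ} (hμ : μ ∈ Set.Icc (0 : ℝ) (1 / 2)) (hc : 2.1 ≤ c)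
    {x : V4} (hx : x ∈ SigmaLC μ c) :
    Admissible c (levi x) (lcAbs (x 0) (x 1)) μ where
  neck := neck_of_mem_SigmaLC hμ hc hx
  lower := lcAbs_lower x
  upper := lcAbs_upper x
  hill := by
    have h := two_mul_Kham μ c x
    rw [(connectedComponentIn_subset _ _ hx).2] at h
    linarith [sq_nonneg (mom₁ μ x), sq_nonneg (mom₂ μ x)]

/-- Derivative of `mom₁` along `v`. -/
def dmom₁ (μ : ℝ) (x v : V4) : ℝ :=
  v 2 - (levi x + μ) * v 1 - 4 * (x 0 * v 0 + x 1 * v 1) * x 1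

/-- Derivative of `mom₂` along `v`. -/
def dmom₂ (μ : ℝ) (x v : V4) : ℝ :=
  v 3 + (levi x - μ) * v 0 + 4 * (x 0 * v 0 + x 1 * v 1) * x 0

/-- Second derivative of the momentum along `v`, paired with the momentum. -/
def magCurv (μ : ℝ) (x v : V4) : ℝ :=
  mom₂ μ x * (4 * (v 0 ^ 2 + v 1 ^ 2) * x 0 + 8 * (x 0 * v 0 + x 1 * v 1) * v 0) -
    mom₁ μ x * (4 * (v 0 ^ 2 + v 1 ^ 2) * x 1 + 8 * (x 0 * v 0 + x 1 * v 1) * v 1)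

/-- First derivative of `lcAbs ^ 2` along `v`. -/
def dSq (x v : V4) : ℝ :=
  8 * (2 * (x 0 ^ 2 - x 1 ^ 2) - 1) * (x 0 * v 0 - x 1 * v 1) +
    32 * (x 0 * x 1) * (v 0 * x 1 + x 0 * v 1)

/-- Second derivative of `lcAbs ^ 2` along `v`. -/
def ddSq (x v : V4) : ℝ :=
  32 * (x 0 * v 0 - x 1 * v 1) ^ 2 +
    8 * (2 * (x 0 ^ 2 - x 1 ^ 2) - 1) * (v 0 ^ 2 - v 1 ^ 2) +
    32 * (v 0 * x 1 + x 0 * v 1) ^ 2 + 64 * (x 0 * x 1) * (v 0 * v 1)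

/-- First derivative of `Kham` along `v`. -/
noncomputable def dKham (μ c : ℝ) (x v : V4) : ℝ :=
  x 2 * v 2 + x 3 * v 3 + 2 * c * (x 0 * v 0 + x 1 * v 1) +
    4 * (x 0 * v 0 + x 1 * v 1) * (x 0 * x 3 - x 1 * x 2) +
    2 * (x 0 ^ 2 + x 1 ^ 2) * (v 0 * x 3 + x 0 * v 3 - v 1 * x 2 - x 1 * v 2) -
    μ * (v 0 * x 3 + x 0 * v 3 + v 1 * x 2 + x 1 * v 2) -
    μ * (2 * (x 0 * v 0 + x 1 * v 1) * (lcAbs (x 0) (x 1))⁻¹ -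
      (x 0 ^ 2 + x 1 ^ 2) * (dSq x v / 2 * (lcAbs (x 0) (x 1))⁻¹ ^ 3))

/-- Second derivative of `Kham` along `v`. -/
noncomputable def ddKham (μ c : ℝ) (x v : V4) : ℝ :=
  v 2 ^ 2 + v 3 ^ 2 + 2 * c * (v 0 ^ 2 + v 1 ^ 2) +
    4 * (v 0 ^ 2 + v 1 ^ 2) * (x 0 * x 3 - x 1 * x 2) +
    8 * (x 0 * v 0 + x 1 * v 1) * (v 0 * x 3 + x 0 * v 3 - v 1 * x 2 - x 1 * v 2) +
    4 * (x 0 ^ 2 + x 1 ^ 2) * (v 0 * v 3 - v 1 * v 2) -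
    2 * μ * (v 0 * v 3 + v 1 * v 2) -
    μ * (2 * (v 0 ^ 2 + v 1 ^ 2) * (lcAbs (x 0) (x 1))⁻¹ -
      4 * (x 0 * v 0 + x 1 * v 1) * (dSq x v / 2 * (lcAbs (x 0) (x 1))⁻¹ ^ 3) +
      (x 0 ^ 2 + x 1 ^ 2) * (3 / 4 * dSq x v ^ 2 * (lcAbs (x 0) (x 1))⁻¹ ^ 5 -
        ddSq x v / 2 * (lcAbs (x 0) (x 1))⁻¹ ^ 3))

/-- Off-diagonal entry of the Hessian of the effective potential. -/
noncomputable def quadMix (μ : ℝ) (x : V4) : ℝ :=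
  6 * μ * (4 * x 0 * x 1) * ((lcAbs (x 0) (x 1))⁻¹ ^ 5 * (1 - levi x * levi x) - 1)

/-- Tangential logarithmic derivative of the effective potential. -/
noncomputable def slopeTan (μ : ℝ) (x : V4) : ℝ :=
  2 * μ * (4 * x 0 * x 1) * (1 - (lcAbs (x 0) (x 1))⁻¹ ^ 3)

theorem inv_lcAbs_sq_mul {x : V4} (hx : x ∈ LCDom) : (lcAbs (x 0) (x 1))⁻¹ ^ 2 *
    ((2 * (x 0 ^ 2 - x 1 ^ 2) - 1) ^ 2 + (4 * x 0 * x 1) ^ 2) = 1 := by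
  rw [← lcAbs_mul_self, ← sq, ← mul_pow, inv_mul_cancel₀ hx, one_pow]

theorem dKham_eq (μ c : ℝ) {x v : V4} (hx : x ∈ LCDom) {a b : ℝ}
    (h0 : v 0 = x 0 * a - x 1 * b) (h1 : v 1 = x 1 * a + x 0 * b) :
    dKham μ c x v = mom₁ μ x * dmom₁ μ x v + mom₂ μ x * dmom₂ μ x v -
      levi x / 2 * (-slopeRad c (levi x) (lcAbs (x 0) (x 1)) μ * a + slopeTan μ x * b) := by
  have hS := inv_lcAbs_sq_mul hx
  simp only [slopeRad, slopeTan, dKham, mom₁, mom₂, dmom₁, dmom₂, lcAbs_mul_self, levi, dSq, h0, h1]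
  set S := (lcAbs (x 0) (x 1))⁻¹
  linear_combination (μ * (x 0 ^ 2 + x 1 ^ 2) * a * S) * hS

theorem ddKham_eq (μ c : ℝ) {x v : V4} (hx : x ∈ LCDom) {a b : ℝ}
    (h0 : v 0 = x 0 * a - x 1 * b) (h1 : v 1 = x 1 * a + x 0 * b) :
    ddKham μ c x v = dmom₁ μ x v ^ 2 + dmom₂ μ x v ^ 2 + magCurv μ x v +
      levi x / 2 * (quadRad c (levi x) (lcAbs (x 0) (x 1)) μ * a ^ 2 +
        2 * quadMix μ x * a * b + quadTan c (levi x) (lcAbs (x 0) (x 1)) μ * b ^ 2 +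
        magT c (levi x) (lcAbs (x 0) (x 1)) μ * (13 / 4 * a ^ 2 + 5 / 4 * b ^ 2)) := by
  have hS := inv_lcAbs_sq_mul hx
  simp only [quadRad, quadMix, quadTan]
  generalize magT c (levi x) (lcAbs (x 0) (x 1)) μ = T
  simp only [ddKham, mom₁, mom₂, dmom₁, dmom₂, magCurv, lcAbs_mul_self, levi, dSq, ddSq, h0, h1]
  set S := (lcAbs (x 0) (x 1))⁻¹
  generalize x 0 = s at *
  generalize x 1 = t at *
  have h3 : S ^ 3 = S ^ 5 * ((2 * (s ^ 2 - t ^ 2) - 1) ^ 2 + (4 * s * t) ^ 2) := by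
    linear_combination -S ^ 3 * hS
  have h1 : S = S ^ 5 * ((2 * (s ^ 2 - t ^ 2) - 1) ^ 2 + (4 * s * t) ^ 2) ^ 2 := by
    linear_combination (-S - S * (S ^ 2 * ((2 * (s ^ 2 - t ^ 2) - 1) ^ 2 + (4 * s * t) ^ 2))) * hS
  linear_combination (-2 * μ * (s ^ 2 + t ^ 2) * (a ^ 2 + b ^ 2)) * h1 +
    μ * (2 * (s ^ 2 + t ^ 2) * a * (8 * (2 * (s ^ 2 - t ^ 2) - 1) *
        (s * (s * a - t * b) - t * (t * a + s * b)) +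
        32 * (s * t) * ((s * a - t * b) * t + s * (t * a + s * b))) +
      (s ^ 2 + t ^ 2) / 2 * (32 * (s * (s * a - t * b) - t * (t * a + s * b)) ^ 2 +
        8 * (2 * (s ^ 2 - t ^ 2) - 1) * ((s * a - t * b) ^ 2 - (t * a + s * b) ^ 2) +
        32 * ((s * a - t * b) * t + s * (t * a + s * b)) ^ 2 +
        64 * (s * t) * ((s * a - t * b) * (t * a + s * b))) -
      (s ^ 2 + t ^ 2) * ((1 + 12 * (s ^ 2 + t ^ 2) ^ 2) * a ^ 2 -
        (5 + 12 * (s ^ 2 + t ^ 2) ^ 2) * b ^ 2)) * h3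

/-- The magnetic curvature is dominated by `magT`. -/
theorem neg_magCurv_le {μ W : ℝ} {x v : V4} {a b : ℝ} (hW : W = mom₁ μ x ^ 2 + mom₂ μ x ^ 2)
    (h0 : v 0 = x 0 * a - x 1 * b) (h1 : v 1 = x 1 * a + x 0 * b) :
    -magCurv μ x v ≤
      levi x / 2 * ((2 / 5 + 5 * (levi x * W)) * (13 / 4 * a ^ 2 + 5 / 4 * b ^ 2)) := by
  have hq := levi_nonneg x
  have hW0 : 0 ≤ W := by rw [hW]; positivity
  refine (abs_le_of_sq_le_sq' ?_ (by positivity)).1 |> neg_le.1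
  have hcs : magCurv μ x v ^ 2 ≤ W * (2 * levi x ^ 3 * ((a ^ 2 + b ^ 2) * (9 * a ^ 2 + b ^ 2))) := by
    simp only [hW, magCurv, levi, h0, h1]
    set X := mom₁ μ x
    set Y := mom₂ μ x
    set D₁ := 4 * ((x 0 * a - x 1 * b) ^ 2 + (x 1 * a + x 0 * b) ^ 2) * x 1 +
      8 * (x 0 * (x 0 * a - x 1 * b) + x 1 * (x 1 * a + x 0 * b)) * (x 1 * a + x 0 * b)
    set D₂ := 4 * ((x 0 * a - x 1 * b) ^ 2 + (x 1 * a + x 0 * b) ^ 2) * x 0 +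
      8 * (x 0 * (x 0 * a - x 1 * b) + x 1 * (x 1 * a + x 0 * b)) * (x 0 * a - x 1 * b)
    refine (by nlinarith [sq_nonneg (Y * D₁ + X * D₂)] :
      (Y * D₂ - X * D₁) ^ 2 ≤ (X ^ 2 + Y ^ 2) * (D₁ ^ 2 + D₂ ^ 2)).trans_eq ?_
    simp only [D₁, D₂]
    ring
  refine hcs.trans ?_
  have hT : 8 * (levi x * W) ≤ (2 / 5 + 5 * (levi x * W)) ^ 2 := by
    nlinarith [sq_nonneg (2 / 5 - 5 * (levi x * W))]
  have hXY : (a ^ 2 + b ^ 2) * (9 * a ^ 2 + b ^ 2) ≤ (13 / 4 * a ^ 2 + 5 / 4 * b ^ 2) ^ 2 := by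
    nlinarith [sq_nonneg (a ^ 2 + b ^ 2 - (9 * a ^ 2 + b ^ 2) / 4)]
  have := mul_le_mul hT hXY (by positivity) (by positivity)
  calc _ = (levi x / 2) ^ 2 * (8 * (levi x * W) * ((a ^ 2 + b ^ 2) * (9 * a ^ 2 + b ^ 2))) := by
        ring
    _ ≤ (levi x / 2) ^ 2 * ((2 / 5 + 5 * (levi x * W)) ^ 2 *
          (13 / 4 * a ^ 2 + 5 / 4 * b ^ 2) ^ 2) := by gcongr
    _ = _ := by ring

/-- A quadratic form plus a square, restricted to the kernel of a linear form, is positive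
when its bordered determinant is. -/
theorem bordered_pos {k A B C la lb p₁ p₂ π₁ π₂ a b : ℝ} (hk : 0 < k) (hB : 0 < B)
    (hD : 0 < k * (la ^ 2 * B - 2 * la * lb * C + lb ^ 2 * A) +
      (p₁ ^ 2 + p₂ ^ 2) * (A * B - C ^ 2))
    (hker : p₁ * π₁ + p₂ * π₂ - k * (la * a + lb * b) = 0) (hne : a ≠ 0 ∨ b ≠ 0) :
    0 < π₁ ^ 2 + π₂ ^ 2 + k * (A * a ^ 2 + 2 * C * a * b + B * b ^ 2) := by
  have hab : 0 < a ^ 2 + b ^ 2 := by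
    rcases hne with h | h <;> positivity
  rcases (by positivity : 0 ≤ p₁ ^ 2 + p₂ ^ 2).eq_or_lt with hW | hW
  · have hp₁ : p₁ = 0 := by nlinarith [sq_nonneg p₁, sq_nonneg p₂]
    have hp₂ : p₂ = 0 := by nlinarith [sq_nonneg p₁, sq_nonneg p₂]
    subst hp₁ hp₂
    have hl : la * a + lb * b = 0 := by
      have : k * (la * a + lb * b) = 0 := by linarith
      exact (mul_eq_zero.1 this).resolve_left hk.ne'
    have hD' : 0 < la ^ 2 * B - 2 * la * lb * C + lb ^ 2 * A := by
      refine pos_of_mul_pos_right (a := k) ?_ hk.le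
      linarith
    have hG : 0 < A * a ^ 2 + 2 * C * a * b + B * b ^ 2 := by
      refine pos_of_mul_pos_right (a := la ^ 2 + lb ^ 2) ?_ (by positivity)
      refine (mul_pos hab hD').trans_eq ?_
      linear_combination (A * (lb * b - la * a) + B * (la * a - lb * b) -
        2 * C * (la * b + lb * a)) * hl
    have := mul_pos hk hG
    positivity
  · set W := p₁ ^ 2 + p₂ ^ 2
    refine pos_of_mul_pos_right (a := W) ?_ hW.le
    have hcs : (k * (la * a + lb * b)) ^ 2 ≤ W * (π₁ ^ 2 + π₂ ^ 2) := by
      rw [← sub_eq_zero.1 hker]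
      nlinarith [sq_nonneg (p₁ * π₂ - p₂ * π₁)]
    have hN : 0 < k * (la * a + lb * b) ^ 2 + W * (A * a ^ 2 + 2 * C * a * b + B * b ^ 2) := by
      have hM : 0 < k * lb ^ 2 + W * B := by positivity
      refine pos_of_mul_pos_right (a := k * lb ^ 2 + W * B) ?_ hM.le
      have hWD := mul_pos hW hD
      have : (k * lb ^ 2 + W * B) *
          (k * (la * a + lb * b) ^ 2 + W * (A * a ^ 2 + 2 * C * a * b + B * b ^ 2)) =
          ((k * lb ^ 2 + W * B) * b + (k * la * lb + W * C) * a) ^ 2 +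
          W * (k * (la ^ 2 * B - 2 * la * lb * C + lb ^ 2 * A) + W * (A * B - C ^ 2)) * a ^ 2 := by
        ring
      rw [this]
      by_cases ha : a = 0
      · subst ha
        have hb : b ≠ 0 := by simpa using hne
        have h := sq_pos_iff.2 (mul_ne_zero hM.ne' hb)
        linarith
      · positivity
    nlinarith [mul_pos hk hN]

theorem four_mul_sq_eq_heron (x : V4) :
    4 * (4 * x 0 * x 1) ^ 2 = heron (levi x) (lcAbs (x 0) (x 1)) := by
  simp only [heron, lcAbs_mul_self, levi]
  ring

theorem convDet_eq (μ c : ℝ) (x : V4) :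
    convDet c (levi x) (lcAbs (x 0) (x 1)) μ =
      levi x / 2 * ((-slopeRad c (levi x) (lcAbs (x 0) (x 1)) μ) ^ 2 *
          quadTan c (levi x) (lcAbs (x 0) (x 1)) μ -
        2 * (-slopeRad c (levi x) (lcAbs (x 0) (x 1)) μ) * slopeTan μ x * quadMix μ x +
        slopeTan μ x ^ 2 * quadRad c (levi x) (lcAbs (x 0) (x 1)) μ) +
      hillW c (levi x) (lcAbs (x 0) (x 1)) μ *
        (quadRad c (levi x) (lcAbs (x 0) (x 1)) μ * quadTan c (levi x) (lcAbs (x 0) (x 1)) μ -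
          quadMix μ x ^ 2) := by
  rw [convDet, ← four_mul_sq_eq_heron, slopeTan, quadMix]
  ring

theorem levi_eq_zero {x : V4} (h : levi x = 0) : x 0 = 0 ∧ x 1 = 0 := by
  unfold levi at h
  constructor <;> nlinarith [sq_nonneg (x 0), sq_nonneg (x 1)]

theorem ddKham_pos {μ c : ℝ} (hμ : μ ∈ Set.Icc (0 : ℝ) (1 / 2)) (hc : 2.1 ≤ c) {x v : V4}
    (hx : x ∈ LCDom)
    (hW : hillW c (levi x) (lcAbs (x 0) (x 1)) μ = mom₁ μ x ^ 2 + mom₂ μ x ^ 2)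
    (hB : 0 < quadTan c (levi x) (lcAbs (x 0) (x 1)) μ)
    (hD : 0 < convDet c (levi x) (lcAbs (x 0) (x 1)) μ)
    (hv : v ≠ 0) (hker : dKham μ c x v = 0) : 0 < ddKham μ c x v := by
  by_cases hz : v 0 = 0 ∧ v 1 = 0
  · have hw : v 2 ≠ 0 ∨ v 3 ≠ 0 := by
      by_contra! h
      exact hv (funext fun i => by fin_cases i <;> simp [hz, h])
    simp only [ddKham, dSq, ddSq, hz]
    have : 0 < v 2 ^ 2 + v 3 ^ 2 := by rcases hw with h | h <;> positivity
    simpa using this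
  rcases (levi_nonneg x).eq_or_lt with hq | hq
  · obtain ⟨h0, h1⟩ := levi_eq_zero hq.symm
    have hρ : lcAbs 0 0 = 1 := by simp [lcAbs]
    have hζ : 0 < v 0 ^ 2 + v 1 ^ 2 := by
      rcases not_and_or.1 hz with h | h <;> positivity
    have hcoef : 0 < 2 * c - 2 * μ - μ ^ 2 := by nlinarith [hμ.1, hμ.2]
    simp only [ddKham, h0, h1, hρ]
    nlinarith [mul_pos hcoef hζ, sq_nonneg (v 3 - μ * v 0), sq_nonneg (v 2 - μ * v 1)]
  · have hN : x 0 ^ 2 + x 1 ^ 2 ≠ 0 := by unfold levi at hq; linarith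
    obtain ⟨a, b, h0, h1⟩ : ∃ a b : ℝ, v 0 = x 0 * a - x 1 * b ∧ v 1 = x 1 * a + x 0 * b :=
      ⟨(x 0 * v 0 + x 1 * v 1) / (x 0 ^ 2 + x 1 ^ 2), (x 0 * v 1 - x 1 * v 0) / (x 0 ^ 2 + x 1 ^ 2),
        by field_simp; ring, by field_simp; ring⟩
    rw [dKham_eq μ c hx h0 h1] at hker
    have hne : a ≠ 0 ∨ b ≠ 0 := by
      by_contra! h
      exact hz (by simp [h0, h1, h])
    rw [convDet_eq, hW] at hD
    have hbd := bordered_pos (half_pos hq) hB hD hker hne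
    have hmag := neg_magCurv_le hW h0 h1
    rw [ddKham_eq μ c hx h0 h1, magT]
    linarith

theorem exists_dKham_ne_zero {μ c : ℝ} (hμ : μ ∈ Set.Icc (0 : ℝ) (1 / 2)) {x : V4}
    (hx : x ∈ LCDom)
    (hW : hillW c (levi x) (lcAbs (x 0) (x 1)) μ = mom₁ μ x ^ 2 + mom₂ μ x ^ 2)
    (hD : 0 < convDet c (levi x) (lcAbs (x 0) (x 1)) μ) : ∃ v, dKham μ c x v ≠ 0 := by
  by_contra! h
  have hp := h ![0, 0, mom₁ μ x, mom₂ μ x]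
  rw [dKham_eq (a := 0) (b := 0) μ c hx (by simp) (by simp)] at hp
  simp only [dmom₁, dmom₂, Matrix.cons_val] at hp
  have hW0 : mom₁ μ x ^ 2 + mom₂ μ x ^ 2 = 0 := by linarith
  have hp₁ : mom₁ μ x = 0 := by nlinarith [sq_nonneg (mom₁ μ x), sq_nonneg (mom₂ μ x)]
  have hp₂ : mom₂ μ x = 0 := by nlinarith [sq_nonneg (mom₁ μ x), sq_nonneg (mom₂ μ x)]
  have hq : levi x / 2 ≠ 0 := by
    intro hq
    rw [hW0, (by linarith : levi x = 0), hillW] at hW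
    linarith [hμ.2]
  have ha := h ![x 0, x 1, 0, 0]
  have hb := h ![-x 1, x 0, 0, 0]
  rw [dKham_eq (a := 1) (b := 0) μ c hx (by simp) (by simp), hp₁, hp₂] at ha
  rw [dKham_eq (a := 0) (b := 1) μ c hx (by simp) (by simp), hp₁, hp₂] at hb
  have hla : slopeRad c (levi x) (lcAbs (x 0) (x 1)) μ = 0 := by
    refine (mul_eq_zero.1 (?_ : levi x / 2 * _ = 0)).resolve_left hq
    linarith
  have hlb : slopeTan μ x = 0 := by
    refine (mul_eq_zero.1 (?_ : levi x / 2 * _ = 0)).resolve_left hq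
    linarith
  rw [convDet_eq, hW, hW0, hla, hlb] at hD
  simp at hD

theorem isOpen_LCDom : IsOpen LCDom :=
  isOpen_ne_fun (by unfold lcAbs; fun_prop) continuous_const

theorem contDiffAt_Kham (μ c : ℝ) {x : V4} (hx : x ∈ LCDom) : ContDiffAt ℝ 2 (Kham μ c) x := by
  have hρ : ContDiffAt ℝ 2 (fun y : V4 => lcAbs (y 0) (y 1)) x := by
    unfold lcAbs
    refine ContDiffAt.sqrt (by fun_prop) ?_
    rw [← lcAbs_mul_self]
    exact mul_self_ne_zero.2 hx
  have : Kham μ c = fun y : V4 => (1/2) * ((y 2)^2 + (y 3)^2) + c * ((y 0)^2 + (y 1)^2) - (1 - μ)/2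
      + 2 * ((y 0)^2 + (y 1)^2) * (y 0 * y 3 - y 1 * y 2)
      - μ * (y 0 * y 3 + y 1 * y 2)
      - μ * ((y 0)^2 + (y 1)^2) * (lcAbs (y 0) (y 1))⁻¹ := rfl
  rw [this]
  fun_prop (disch := exact hx)

theorem hasDerivAt_coord (x v : V4) (i : Fin 4) :
    HasDerivAt (fun t : ℝ => (x + t • v) i) (v i) 0 := by
  simpa using ((hasDerivAt_id (0 : ℝ)).mul_const (v i)).const_add (x i)

theorem hasDerivAt_inv_lcAbs {x : V4} (hx : x ∈ LCDom) (v : V4) :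
    HasDerivAt (fun t : ℝ => (lcAbs ((x + t • v) 0) ((x + t • v) 1))⁻¹)
      (-(dSq x v / 2 * (lcAbs (x 0) (x 1))⁻¹ ^ 3)) 0 := by
  have hρ : lcAbs (x 0) (x 1) ≠ 0 := hx
  have h0 := hasDerivAt_coord x v 0
  have h1 := hasDerivAt_coord x v 1
  have hP : HasDerivAt (fun t : ℝ => (2 * (((x + t • v) 0) ^ 2 - ((x + t • v) 1) ^ 2) - 1) ^ 2 +
      (4 * ((x + t • v) 0) * ((x + t • v) 1)) ^ 2) (dSq x v) 0 := by
    refine ((((((h0.pow 2).sub (h1.pow 2)).const_mul 2).sub_const 1).pow 2).add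
      (((h0.const_mul 4).mul h1).pow 2)).congr_deriv ?_
    simp [dSq]
    ring
  have hne : (2 * (((x + (0 : ℝ) • v) 0) ^ 2 - ((x + (0 : ℝ) • v) 1) ^ 2) - 1) ^ 2 +
      (4 * ((x + (0 : ℝ) • v) 0) * ((x + (0 : ℝ) • v) 1)) ^ 2 ≠ 0 := by
    rw [← lcAbs_mul_self]
    simpa using hρ
  have hsqrt : HasDerivAt (fun t : ℝ => lcAbs ((x + t • v) 0) ((x + t • v) 1))
      (dSq x v / (2 * lcAbs (x 0) (x 1))) 0 :=
    (hP.sqrt hne).congr_deriv (by simp [lcAbs])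
  refine (hsqrt.fun_inv (by simpa using hρ)).congr_deriv ?_
  simp
  field_simp

theorem hasDerivAt_Kham (μ c : ℝ) {x : V4} (hx : x ∈ LCDom) (v : V4) :
    HasDerivAt (fun t : ℝ => Kham μ c (x + t • v)) (dKham μ c x v) 0 := by
  have h0 := hasDerivAt_coord x v 0
  have h1 := hasDerivAt_coord x v 1
  have h2 := hasDerivAt_coord x v 2
  have h3 := hasDerivAt_coord x v 3
  have hS := hasDerivAt_inv_lcAbs hx v
  have hN := (h0.pow 2).add (h1.pow 2)
  unfold Kham
  simp only [div_eq_mul_inv _ (lcAbs _ _)]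
  refine ((((((((h2.pow 2).add (h3.pow 2)).const_mul (1 / 2)).add (hN.const_mul c)).sub_const
    ((1 - μ) / 2)).add ((hN.const_mul 2).mul ((h0.mul h3).sub (h1.mul h2)))).sub
    (((h0.mul h3).add (h1.mul h2)).const_mul μ)).sub ((hN.const_mul μ).mul hS)).congr_deriv ?_
  simp [dKham]
  ring

theorem hasDerivAt_dSq (x v : V4) :
    HasDerivAt (fun t : ℝ => dSq (x + t • v) v) (ddSq x v) 0 := by
  have h0 := hasDerivAt_coord x v 0
  have h1 := hasDerivAt_coord x v 1
  unfold dSq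
  refine ((((((((h0.pow 2).sub (h1.pow 2)).const_mul 2).sub_const 1).const_mul 8).mul
    ((h0.mul_const (v 0)).sub (h1.mul_const (v 1))))).add
    (((h0.mul h1).const_mul 32).mul ((h1.const_mul (v 0)).add (h0.mul_const (v 1))))).congr_deriv ?_
  simp [ddSq]
  ring

theorem hasDerivAt_dKham (μ c : ℝ) {x : V4} (hx : x ∈ LCDom) (v : V4) :
    HasDerivAt (fun t : ℝ => dKham μ c (x + t • v) v) (ddKham μ c x v) 0 := by
  have h0 := hasDerivAt_coord x v 0
  have h1 := hasDerivAt_coord x v 1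
  have h2 := hasDerivAt_coord x v 2
  have h3 := hasDerivAt_coord x v 3
  have hS := hasDerivAt_inv_lcAbs hx v
  have hN := (h0.pow 2).add (h1.pow 2)
  have hP := hasDerivAt_dSq x v
  have hM := (h0.mul_const (v 0)).add (h1.mul_const (v 1))
  have hJ := (h0.mul h3).sub (h1.mul h2)
  unfold dKham
  refine (((((((h2.mul_const (v 2)).add (h3.mul_const (v 3))).add (hM.const_mul (2 * c))).add
    ((hM.const_mul 4).mul hJ)).add ((hN.const_mul 2).mul
      ((((h3.const_mul (v 0)).add (h0.mul_const (v 3))).sub (h2.const_mul (v 1))).sub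
        (h1.mul_const (v 2))))).sub
    (((((h3.const_mul (v 0)).add (h0.mul_const (v 3))).add (h2.const_mul (v 1))).add
      (h1.mul_const (v 2))).const_mul μ)).sub
    ((((hM.const_mul 2).mul hS).sub (hN.mul ((hP.div_const 2).mul (hS.pow 3)))).const_mul μ)).congr_deriv ?_
  simp [ddKham]
  ring

theorem fderiv_Kham_apply (μ c : ℝ) {x : V4} (hx : x ∈ LCDom) (v : V4) :
    fderiv ℝ (Kham μ c) x v = dKham μ c x v := by
  have h := ((contDiffAt_Kham μ c hx).differentiableAt (by norm_num)).hasFDerivAt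
  have hline : HasDerivAt (fun t : ℝ => x + t • v) v 0 := by
    simpa using ((hasDerivAt_id (0 : ℝ)).smul_const v).const_add x
  have h' : HasFDerivAt (Kham μ c) (fderiv ℝ (Kham μ c) x) (x + (0 : ℝ) • v) := by simpa using h
  have h1 : HasDerivAt (fun t : ℝ => Kham μ c (x + t • v)) (fderiv ℝ (Kham μ c) x v) 0 :=
    HasFDerivAt.comp_hasDerivAt (l := Kham μ c) 0 h' hline
  exact h1.unique (hasDerivAt_Kham μ c hx v)

theorem iteratedFDeriv_Kham_apply (μ c : ℝ) {x : V4} (hx : x ∈ LCDom) (v : V4) :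
    iteratedFDeriv ℝ 2 (Kham μ c) x ![v, v] = ddKham μ c x v := by
  rw [iteratedFDeriv_two_apply]
  simp only [Matrix.cons_val]
  have h := (((contDiffAt_Kham μ c hx).fderiv_right (m := 1) (by norm_num)).differentiableAt
    (by norm_num)).hasFDerivAt
  have hline : HasDerivAt (fun t : ℝ => x + t • v) v 0 := by
    simpa using ((hasDerivAt_id (0 : ℝ)).smul_const v).const_add x
  have h' : HasFDerivAt (fderiv ℝ (Kham μ c)) (fderiv ℝ (fderiv ℝ (Kham μ c)) x)
      (x + (0 : ℝ) • v) := by simpa using h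
  have h1 : HasDerivAt (fun t : ℝ => fderiv ℝ (Kham μ c) (x + t • v))
      (fderiv ℝ (fderiv ℝ (Kham μ c)) x v) 0 := h'.comp_hasDerivAt 0 hline
  have h3 := h1.clm_apply (hasDerivAt_const (0 : ℝ) v)
  rw [map_zero, add_zero] at h3
  have hmem : ∀ᶠ t : ℝ in nhds 0, x + t • v ∈ LCDom :=
    hline.continuousAt.eventually_mem (isOpen_LCDom.mem_nhds (by simpa using hx))
  have h2 := (hasDerivAt_dKham μ c hx v).congr_of_eventuallyEq
    (hmem.mono fun t ht => fderiv_Kham_apply μ c ht v)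
  exact h3.unique h2

/-- For every `μ ∈ [0,1/2]`, `c ∈ [2.1, 2.1+10⁻⁶]` and every `x ∈ Σ_{μ,c}`,
the differential `DK_{μ,c}(x)` is nonzero and the Hessian `D²K_{μ,c}(x)` is positive
definite on the tangent hyperplane `ker DK_{μ,c}(x)` (positive Gauss–Kronecker curvature). -/
theorem statement13 (μ c : ℝ) (hμ : μ ∈ Set.Icc (0:ℝ) (1/2))
    (hc : c ∈ Set.Icc (2.1:ℝ) (2.1 + 1/1000000))
    (x : V4) (hx : x ∈ SigmaLC μ c) :
    fderiv ℝ (Kham μ c) x ≠ 0 ∧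
    ∀ v : V4, v ≠ 0 → fderiv ℝ (Kham μ c) x v = 0 →
      0 < iteratedFDeriv ℝ 2 (Kham μ c) x ![v, v] := by
  have hK := connectedComponentIn_subset _ _ hx
  have hdom : x ∈ LCDom := hK.1
  have hW : hillW c (levi x) (lcAbs (x 0) (x 1)) μ = mom₁ μ x ^ 2 + mom₂ μ x ^ 2 := by
    have h := two_mul_Kham μ c x
    rw [hK.2] at h
    linarith
  obtain ⟨hB, hD⟩ := (admissible_of_mem_SigmaLC hμ hc.1 hx).pos hc hμ (levi_nonneg x)
    (lcAbs_nonneg _ _)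
  constructor
  · intro h
    obtain ⟨v, hv⟩ := exists_dKham_ne_zero hμ hdom hW hD
    exact hv (by rw [← fderiv_Kham_apply μ c hdom, h, _root_.zero_apply])
  · intro v hv hker
    rw [fderiv_Kham_apply μ c hdom] at hker
    rw [iteratedFDeriv_Kham_apply μ c hdom]
    exact ddKham_pos hμ hc.1 hdom hW hB hD hv hker
end

section
/- For every μ ∈ [0, 1/2] and every c ≥ 2.1, every point (z,w) ∈ Σ_{μ,c} satisfies 2|z|² ≤ (3−2μ)/5; in particular 2|z|² ≤ 3/5. -/
open Matrix Set

/-- The worst case of the energy bound on the sphere `2|z|² = (3-2μ)/5`. -/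
lemma energy_bound_at_radius (μ : ℝ) (h0 : 0 ≤ μ) (h1 : μ ≤ 1/2) :
    ((3 - 2*μ)/5 - μ)^2/2 + μ/(1 - (3 - 2*μ)/5) + (1 - μ)/((3 - 2*μ)/5) < 2.1 := by
  have e : ((3 - 2*μ)/5 - μ)^2/2 + μ/(1 - (3 - 2*μ)/5) + (1 - μ)/((3 - 2*μ)/5)
      = ((3 - 7*μ)^2 * ((2 + 2*μ)*(3 - 2*μ))
        + 250 * μ * (3 - 2*μ) + 250 * (1 - μ) * (2 + 2*μ)) / (50 * ((2 + 2*μ)*(3 - 2*μ))) := by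
    have a : 1 - (3 - 2*μ)/5 ≠ 0 := by linarith
    have b : 3 - 2*μ ≠ 0 := by linarith
    have d : 2 + 2*μ ≠ 0 := by linarith
    have a' : 1 - (3 - 2*μ)/5 = (2 + 2*μ)/5 := by ring
    rw [a']
    field_simp
    ring
  rw [e, div_lt_iff₀ (by have : 0 < 3 - 2*μ := by linarith
                         positivity)]
  nlinarith [mul_nonneg h0 (sub_nonneg.2 h1), sq_nonneg (μ * (μ - 1/2)), sq_nonneg (μ - 1/2),
    mul_nonneg h0 (sq_nonneg (μ - 1/2)), mul_nonneg (sub_nonneg.2 h1) (sq_nonneg μ)]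

/-- On an interval `[1-r, 1+r]` the function `D²/2 + 1/D` is maximal at `1-r`. -/
lemma half_sq_add_inv_le (r D : ℝ) (hr1 : r < 1) (hD : 1 - r ≤ D) (hD' : D ≤ 1 + r) :
    D^2/2 + 1/D ≤ (1 - r)^2/2 + 1/(1 - r) := by
  have hd : 0 < 1 - r := by linarith
  have hDp : 0 < D := by linarith
  have e : (1 - r)^2/2 + 1/(1 - r) - (D^2/2 + 1/D)
      = (D - (1 - r)) * (2 - (D + (1 - r)) * (D * (1 - r))) / (2 * (D * (1 - r))) := by
    field_simp
    ring
  have h1 : D * (1 - r) ≤ 1 := by nlinarith [sq_nonneg r]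
  have h2 : (D + (1 - r)) * (D * (1 - r)) ≤ 2 * 1 :=
    mul_le_mul (by linarith) h1 (by positivity) (by norm_num)
  have : 0 ≤ (D - (1 - r)) * (2 - (D + (1 - r)) * (D * (1 - r))) / (2 * (D * (1 - r))) :=
    div_nonneg (mul_nonneg (by linarith) (by linarith)) (by positivity)
  linarith

/-- The zero set of `K_{μ,c}` does not meet the sphere `2|z|² = (3-2μ)/5`. -/
lemma Kham_pos_of_radius (μ c : ℝ) (hμ : μ ∈ Set.Icc (0:ℝ) (1/2)) (hc : 2.1 ≤ c)
    (x : V4) (hr : 2 * ((x 0)^2 + (x 1)^2) = (3 - 2*μ)/5) : 0 < Kham μ c x := by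
  obtain ⟨h0, h1⟩ := hμ
  set r : ℝ := (3 - 2*μ)/5 with hrdef
  have hr0 : 0 < r := by rw [hrdef]; linarith
  have hr1 : r < 1 := by rw [hrdef]; linarith
  have hDsq : lcAbs (x 0) (x 1) ^ 2 = 1 + r^2 - 4 * ((x 0)^2 - (x 1)^2) := by
    rw [lcAbs, Real.sq_sqrt (by positivity), ← hr]
    ring
  have hDnn : 0 ≤ lcAbs (x 0) (x 1) := Real.sqrt_nonneg _
  unfold Kham
  generalize lcAbs (x 0) (x 1) = D at hDsq hDnn ⊢
  have hD : 1 - r ≤ D := by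
    rw [← pow_le_pow_iff_left₀ (by linarith) hDnn two_ne_zero]
    nlinarith [sq_nonneg (x 1)]
  have hD' : D ≤ 1 + r := by
    rw [← pow_le_pow_iff_left₀ hDnn (by linarith) two_ne_zero]
    nlinarith [sq_nonneg (x 0)]
  have hb := mul_le_mul_of_nonneg_left (half_sq_add_inv_le r D hr1 hD hD') h0
  have he := energy_bound_at_radius μ h0 h1
  rw [← hrdef] at he
  have hkey : 0 < r/2 * (c - (r^2 + μ^2)/2 + μ * (1 + r^2 - D^2)/2 - μ * (1/D) - (1 - μ)/r) := by
    apply mul_pos (by linarith)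
    have : μ/(1 - r) = μ * (1/(1 - r)) := by ring
    nlinarith
  have e1 : r/2 * ((1 - μ)/r) = (1 - μ)/2 := by field_simp
  have e2 : (x 0)^2 + (x 1)^2 = r/2 := by linarith
  have e3 : (x 2 - (r + μ) * x 1)^2 + (x 3 + (r - μ) * x 0)^2
      = (x 2)^2 + (x 3)^2 + 2 * (r * (x 0 * x 3 - x 1 * x 2) - μ * (x 0 * x 3 + x 1 * x 2))
        + (r^2 + μ^2) * ((x 0)^2 + (x 1)^2) - 2 * r * μ * ((x 0)^2 - (x 1)^2) := by ring
  have e4 : (x 0)^2 - (x 1)^2 = (1 + r^2 - D^2)/4 := by linarith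
  rw [e2, e4] at e3
  rw [e2]
  have e5 : μ * (r/2) / D = r/2 * (μ * (1/D)) := by ring
  rw [e5]
  nlinarith [sq_nonneg (x 2 - (r + μ) * x 1), sq_nonneg (x 3 + (r - μ) * x 0)]

/-- For every `μ ∈ [0,1/2]` and `c ≥ 2.1`, every `(z,w) ∈ Σ_{μ,c}` satisfies
`2|z|² ≤ (3-2μ)/5`; in particular `2|z|² ≤ 3/5`. -/
theorem statement14 (μ c : ℝ) (hμ : μ ∈ Set.Icc (0:ℝ) (1/2)) (hc : 2.1 ≤ c)
    (x : V4) (hx : x ∈ SigmaLC μ c) :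
    2 * ((x 0)^2 + (x 1)^2) ≤ (3 - 2*μ)/5 ∧ 2 * ((x 0)^2 + (x 1)^2) ≤ 3/5 := by
  suffices h : 2 * ((x 0)^2 + (x 1)^2) ≤ (3 - 2*μ)/5 from ⟨h, by linarith [hμ.1]⟩
  by_contra! hlt
  have hbase := mem_connectedComponentIn (connectedComponentIn_nonempty_iff.1 ⟨x, hx⟩)
  have hcont : Continuous fun y : V4 => 2 * ((y 0)^2 + (y 1)^2) := by fun_prop
  obtain ⟨y, hy, hyr⟩ := isPreconnected_connectedComponentIn.intermediate_value hbase hx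
    hcont.continuousOn (show (3 - 2*μ)/5 ∈ Set.Icc _ _ from
      ⟨by simp; linarith [hμ.2], hlt.le⟩)
  exact (Kham_pos_of_radius μ c hμ hc y hyr).ne' (connectedComponentIn_subset _ _ hy).2
end

section
/- Let μ ∈ [0, 1/2] and c ≥ 2. If (z,w) ∈ ℂ² satisfies 2z² ≠ 1, K_{μ,c}(z,w) = 0 and 2|z|² ≤ 3/5, then |w| ≤ 2. -/
open Matrix Set

/-- For `μ ∈ [0,1/2]` and `c ≥ 2`, if `(z,w)` satisfies `2z² ≠ 1`,
`K_{μ,c}(z,w) = 0` and `2|z|² ≤ 3/5`, then `|w| ≤ 2`. -/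
theorem statement15 (μ c : ℝ) (hμ : μ ∈ Set.Icc (0:ℝ) (1/2)) (hc : 2 ≤ c)
    (x : V4) (hdom : x ∈ LCDom) (hK : Kham μ c x = 0)
    (hz : 2 * ((x 0)^2 + (x 1)^2) ≤ 3/5) :
    Real.sqrt ((x 2)^2 + (x 3)^2) ≤ 2 := by
  obtain ⟨hμ0, hμ1⟩ := hμ
  unfold Kham at hK
  have hsq : lcAbs (x 0) (x 1) ^ 2
      = (2*((x 0)^2 - (x 1)^2) - 1)^2 + (4*x 0*x 1)^2 := Real.sq_sqrt (by positivity)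
  have hd0 : 0 ≤ lcAbs (x 0) (x 1) := Real.sqrt_nonneg _
  generalize lcAbs (x 0) (x 1) = d at hK hsq hd0
  generalize x 0 = a at *
  generalize x 1 = b at *
  generalize x 2 = u at *
  generalize x 3 = v at *
  obtain ⟨s, hs⟩ : ∃ s, s = a ^ 2 + b ^ 2 := ⟨_, rfl⟩
  have hs0 : 0 ≤ s := by rw [hs]; positivity
  rw [← hs] at hK hz
  have hd : 2 / 5 ≤ d := by
    have h1 : (1 - 2 * s) ^ 2 ≤ d ^ 2 := by
      rw [hsq, hs]
      nlinarith [sq_nonneg b]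
    have h2 : 1 - 2 * s ≤ d := (abs_le_of_sq_le_sq' h1 hd0).2
    linarith
  have hfrac : μ * s / d ≤ c * s := by
    rw [div_le_iff₀ (by linarith)]
    have h1 : 2 * (2 / 5) ≤ c * d := mul_le_mul hc hd (by norm_num) (by linarith)
    nlinarith
  have hp : (2 * s + μ) ^ 2 ≤ (11 / 10) ^ 2 := by
    apply pow_le_pow_left₀ <;> linarith
  have hm : (2 * s - μ) ^ 2 ≤ (11 / 10) ^ 2 := by
    apply sq_le_sq' <;> linarith
  have hb := mul_le_mul_of_nonneg_right hp (sq_nonneg b)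
  have ha := mul_le_mul_of_nonneg_right hm (sq_nonneg a)
  have hw : u ^ 2 + v ^ 2 ≤ 2 ^ 2 := by
    nlinarith [sq_nonneg (u / 2 - (2 * s + μ) * b), sq_nonneg (v / 2 + (2 * s - μ) * a)]
  exact (Real.sqrt_le_left (by norm_num : (0:ℝ) ≤ 2)).mpr hw
end

section
/- For all μ, c ∈ ℝ and all (z,w) ∈ ℂ² with 2z² ≠ 1, the Levi-Civita Hamiltonian satisfies the identity K_{μ,c}(z,w) = ½|w + A(z)z|² + zᵀ B(z) z − (1−μ)/2, where z is regarded as the vector (z₁,z₂) ∈ ℝ², w as (w₁,w₂) ∈ ℝ², A(z) = [[0, −(2|z|²+μ)],[2|z|²−μ, 0]], and B(z) is the diagonal matrix with diagonal entries c − ½(2|z|²−μ)² − μ/|2z²−1| and c − ½(2|z|²+μ)² − μ/|2z²−1|. -/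
open Matrix Set

/-- The Levi-Civita Hamiltonian can be rewritten as
`K_{μ,c}(z,w) = ½|w + A(z)z|² + zᵀB(z)z - (1-μ)/2` with
`A(z) = [[0, -(2|z|²+μ)],[2|z|²-μ, 0]]` and `B(z)` diagonal with entries
`c - ½(2|z|²-μ)² - μ/|2z²-1|` and `c - ½(2|z|²+μ)² - μ/|2z²-1|`. -/
theorem statement16 (μ c z1 z2 w1 w2 : ℝ) (h : lcAbs z1 z2 ≠ 0) :
    Kham μ c ![z1, z2, w1, w2]
      = (1/2) *
          ((![w1, w2] + (!![0, -(2*(z1^2 + z2^2) + μ); 2*(z1^2 + z2^2) - μ, 0] : M2).mulVec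
              ![z1, z2]) ⬝ᵥ
           (![w1, w2] + (!![0, -(2*(z1^2 + z2^2) + μ); 2*(z1^2 + z2^2) - μ, 0] : M2).mulVec
              ![z1, z2]))
        + ![z1, z2] ⬝ᵥ
            (Matrix.diagonal
              ![c - (1/2)*(2*(z1^2 + z2^2) - μ)^2 - μ / lcAbs z1 z2,
                c - (1/2)*(2*(z1^2 + z2^2) + μ)^2 - μ / lcAbs z1 z2]).mulVec ![z1, z2]
        - (1 - μ)/2 := by
  simp only [Kham, dotProduct, mulVec_diagonal, Fin.sum_univ_two, Pi.add_apply]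
  simp [mulVec, dotProduct]
  ring
end

section
/- Let μ, c ∈ ℝ with κ := 2c − μ² − 2μ > 0 and let w = (w₁,w₂) ∈ ℝ²∖{0}. Then the symmetric 3×3 matrix M = [[κ|w|², μκ(w₂² − w₁²), 0], [μκ(w₂² − w₁²), |w|²(1 − 2μ³ + 2(c+1)μ²), 2κμw₁w₂], [0, 2κμw₁w₂, κ|w|²]] has determinant det M = κ² |w|⁶ (1 + μ²)² > 0, and M is positive definite. -/
open Matrix Set

/-- For `κ = 2c - μ² - 2μ > 0` and `w = (w₁,w₂) ≠ 0`, the symmetric 3×3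
matrix `M = [[κ|w|², μκ(w₂²-w₁²), 0],[μκ(w₂²-w₁²), |w|²(1-2μ³+2(c+1)μ²), 2κμw₁w₂],`
`[0, 2κμw₁w₂, κ|w|²]]` has determinant `κ²|w|⁶(1+μ²)² > 0` and is positive definite. -/
theorem statement17 (μ c w1 w2 : ℝ) (hκ : 0 < 2*c - μ^2 - 2*μ)
    (hw : ¬(w1 = 0 ∧ w2 = 0))
    (M : Matrix (Fin 3) (Fin 3) ℝ)
    (hM : M = !![(2*c - μ^2 - 2*μ)*(w1^2 + w2^2),
                  μ*(2*c - μ^2 - 2*μ)*(w2^2 - w1^2), 0;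
                 μ*(2*c - μ^2 - 2*μ)*(w2^2 - w1^2),
                  (w1^2 + w2^2)*(1 - 2*μ^3 + 2*(c + 1)*μ^2),
                  2*(2*c - μ^2 - 2*μ)*μ*w1*w2;
                 0, 2*(2*c - μ^2 - 2*μ)*μ*w1*w2,
                  (2*c - μ^2 - 2*μ)*(w1^2 + w2^2)]) :
    M.det = (2*c - μ^2 - 2*μ)^2 * (w1^2 + w2^2)^3 * (1 + μ^2)^2 ∧
    0 < M.det ∧ M.PosDef := by
  set N := w1^2 + w2^2 with hN
  have hNpos : 0 < N := by
    rcases not_and_or.mp hw with h | h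
    · have := pow_pos (abs_pos.mpr h) 2
      rw [sq_abs] at this
      positivity
    · have := pow_pos (abs_pos.mpr h) 2
      rw [sq_abs] at this
      positivity
  have hdet : M.det = (2*c - μ^2 - 2*μ)^2 * N^3 * (1 + μ^2)^2 := by
    rw [hM, Matrix.det_fin_three]
    simp
    ring
  refine ⟨hdet, by rw [hdet]; positivity, ?_⟩
  refine Matrix.PosDef.of_dotProduct_mulVec_pos ?_ fun x hx => ?_
  · subst hM
    ext i j
    fin_cases i <;> fin_cases j <;> simp
  · set κ := 2*c - μ^2 - 2*μ with hκdef
    -- Completing the square in the first and third coordinates.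
    have key : N * (star x ⬝ᵥ (M *ᵥ x)) =
        κ * (N * x 0 + μ * (w2^2 - w1^2) * x 1)^2
          + κ * (N * x 2 + 2 * μ * w1 * w2 * x 1)^2 + (N * (1 + μ^2) * x 1)^2 := by
      rw [hM]
      simp [dotProduct, Matrix.mulVec, Fin.sum_univ_three]
      ring
    refine pos_of_mul_pos_right (a := N) ?_ hNpos.le
    rw [key]
    by_cases h1 : x 1 = 0
    · simp only [h1, mul_zero, add_zero]
      by_cases h0 : x 0 = 0
      · have h2 : x 2 ≠ 0 := fun h2 => hx (by ext i; fin_cases i <;> assumption)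
        positivity
      · positivity
    · positivity
end
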